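/- arXiv:1410.8272 — 3 statements merged into one kernel-verified Lean document; each statement's English description precedes it below -/
import Mathlib

section
/- Let n ≥ 3 and let P ⊆ ℝⁿ be a lattice n-polytope such that P ∩ ℤⁿ has at least n+2 elements and the topological interior of the dilate (n−1)P contains exactly one point of ℤⁿ. Then P is normal: for every integer k ≥ 1, (kP) ∩ ℤⁿ + P ∩ ℤⁿ = ((k+1)P) ∩ ℤⁿ. (This is the lattice-polytope form of the statement that an ample line bundle L on a projective toric n-fold with dim Γ(X, L) ≥ n+2 and dim Γ(X, L^{⊗(n−1)} ⊗ ω_X) = 1 is normally generated.) -/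
open Set Pointwise

noncomputable section

/-- The set of lattice points of `ℝⁿ`: points with all coordinates integers. -/
def lat (n : ℕ) : Set (Fin n → ℝ) := {x | ∀ i, ∃ z : ℤ, x i = (z : ℝ)}

/-- The dilate `kP` of a subset `P ⊆ ℝⁿ`. -/
def dilate (n k : ℕ) (P : Set (Fin n → ℝ)) : Set (Fin n → ℝ) :=
  (fun x => (k : ℝ) • x) '' P

/-- A lattice `n`-polytope: the convex hull of finitely many lattice points,
whose affine hull is all of `ℝⁿ`. -/
def IsLatticePolytope (n : ℕ) (P : Set (Fin n → ℝ)) : Prop :=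
  (∃ S : Finset (Fin n → ℤ), S.Nonempty ∧
    P = convexHull ℝ ((fun m : Fin n → ℤ => fun i => (m i : ℝ)) '' (S : Set (Fin n → ℤ)))) ∧
  affineSpan ℝ P = ⊤

/-- The cone of `P` at a point `v`: `C_v(P) = {r • (x - v) : r ≥ 0, x ∈ P}`. -/
def coneAt (n : ℕ) (P : Set (Fin n → ℝ)) (v : Fin n → ℝ) : Set (Fin n → ℝ) :=
  {y | ∃ r : ℝ, 0 ≤ r ∧ ∃ x ∈ P, y = r • (x - v)}

/-- `P` is Gorenstein at `v`: there is a lattice point `m₀` in `C_v(P)` with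
`Int(C_v(P)) ∩ ℤⁿ = m₀ + (C_v(P) ∩ ℤⁿ)`. -/
def GorensteinAt (n : ℕ) (P : Set (Fin n → ℝ)) (v : Fin n → ℝ) : Prop :=
  ∃ m₀ ∈ coneAt n P v ∩ lat n,
    interior (coneAt n P v) ∩ lat n = (fun y => m₀ + y) '' (coneAt n P v ∩ lat n)

/-- `P` is Gorenstein: it is Gorenstein at every vertex (extreme point). -/
def Gorenstein (n : ℕ) (P : Set (Fin n → ℝ)) : Prop :=
  ∀ v ∈ Set.extremePoints ℝ P, GorensteinAt n P v

/-- `F` is a facet of the `n`-polytope `P`: a face (extreme subset) of dimension `n-1`. -/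
def IsFacet (n : ℕ) (P F : Set (Fin n → ℝ)) : Prop :=
  IsExtreme ℝ P F ∧ Module.finrank ℝ (affineSpan ℝ F).direction = n - 1

/-- `P` is a pyramid: there are a facet `F` and a vertex `v ∉ F` with `P = Conv(F ∪ {v})`. -/
def IsPyramid (n : ℕ) (P : Set (Fin n → ℝ)) : Prop :=
  ∃ F v, IsFacet n P F ∧ v ∈ Set.extremePoints ℝ P ∧ v ∉ F ∧
    P = convexHull ℝ (F ∪ {v})

/-- The simplex `D_n = Conv{0, e₁, e₂, e₁+e₂+2e₃, e₄, …, eₙ}` (standard basis `e₁, …, eₙ`,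
so `eᵢ = Pi.single i⁻¹` with 0-based indices; the points `Pi.single i 1` for `(i : ℕ) ≠ 2`
are `e₁, e₂, e₄, …, eₙ`, and the last listed point is `e₁ + e₂ + 2e₃`). -/
def Dn (n : ℕ) : Set (Fin n → ℝ) :=
  convexHull ℝ ({0} ∪ {x | ∃ i : Fin n, (i : ℕ) ≠ 2 ∧ x = Pi.single i (1 : ℝ)} ∪
    {fun j : Fin n => if (j : ℕ) = 0 ∨ (j : ℕ) = 1 then (1 : ℝ) else
      if (j : ℕ) = 2 then 2 else 0})

/-- The affine map `x ↦ A·x + b` of `ℝⁿ` given by an integral matrix `A` and `b ∈ ℤⁿ`. -/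
def unimodularMap (n : ℕ) (A : Matrix (Fin n) (Fin n) ℤ) (b : Fin n → ℤ) :
    (Fin n → ℝ) → (Fin n → ℝ) :=
  fun x => (A.map (Int.cast : ℤ → ℝ)).mulVec x + fun i => (b i : ℝ)

/-- The basic simplex `Conv{0, e₁, …, eₙ}`. -/
def basicSimplex (n : ℕ) : Set (Fin n → ℝ) :=
  convexHull ℝ ({0} ∪ Set.range fun i : Fin n => (Pi.single i (1 : ℝ) : Fin n → ℝ))

/-- A ray (one-dimensional face) of a cone `C`. -/
def IsRay (n : ℕ) (C ρ : Set (Fin n → ℝ)) : Prop :=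
  IsExtreme ℝ C ρ ∧ Module.finrank ℝ (Submodule.span ℝ ρ) = 1

/-- The lattice points of `ℝⁿ`, as an additive subgroup. -/
def latSubgroup (n : ℕ) : AddSubgroup (Fin n → ℝ) where
  carrier := lat n
  zero_mem' _ := ⟨0, by simp⟩
  add_mem' {x y} hx hy i := by
    obtain ⟨p, hp⟩ := hx i
    obtain ⟨q, hq⟩ := hy i
    exact ⟨p + q, by simp [hp, hq]⟩
  neg_mem' {x} hx i := by
    obtain ⟨p, hp⟩ := hx i
    exact ⟨-p, by simp [hp]⟩

/-- A point of the convex hull of a spanning set `V` lies in a full-dimensional simplex with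
vertices in `V`. -/
lemma exists_affineBasis_subset_of_mem_convexHull {E : Type*} [AddCommGroup E] [Module ℝ E]
    {V : Set E} (hV : affineSpan ℝ V = ⊤) {q : E} (hq : q ∈ convexHull ℝ V) :
    ∃ (t : Set E) (b : AffineBasis t ℝ E), t ⊆ V ∧ (∀ i, b i = i) ∧ ∀ i, 0 ≤ b.coord i q := by
  rw [convexHull_eq_union] at hq
  simp only [Set.mem_iUnion] at hq
  obtain ⟨s, hsV, hs, hqs⟩ := hq
  obtain ⟨p, hp⟩ : (s : Set E).Nonempty := convexHull_nonempty_iff.1 ⟨q, hqs⟩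
  have hs' := (affineIndependent_set_iff_linearIndependent_vsub ℝ hp).1 hs
  obtain ⟨u, huV, hsu, hVu, hu⟩ := exists_linearIndepOn_extension (v := id) hs'
    (t := (fun x => x -ᵥ p) '' (V \ {p})) (image_mono (by gcongr))
  simp only [image_id] at hVu
  have hu0 : ∀ v ∈ u, v ≠ (0 : E) := fun v hv => hu.ne_zero hv
  have hind := (linearIndependent_set_iff_affineIndependent_vadd_union_singleton ℝ hu0 p).1 hu
  have hspan : Submodule.span ℝ u = ⊤ := by
    rw [eq_top_iff, ← AffineSubspace.direction_top ℝ E E, ← hV, direction_affineSpan,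
      vectorSpan_eq_span_vsub_set_right_ne ℝ (hsV hp)]
    exact Submodule.span_le.2 hVu
  set t : Set E := {p} ∪ (fun v => v +ᵥ p) '' u with ht
  have htop : affineSpan ℝ t = ⊤ :=
    affineSpan_singleton_union_vadd_eq_top_of_span_eq_top p (by simpa using hspan)
  let b : AffineBasis t ℝ E := ⟨(↑), hind, by simpa using htop⟩
  have hb : range b = t := Subtype.range_coe
  have hst : (s : Set E) ⊆ t := by
    intro x hx
    by_cases hxp : x = p
    · exact Or.inl hxp
    · exact Or.inr ⟨x -ᵥ p, hsu ⟨x, ⟨hx, hxp⟩, rfl⟩, by simp⟩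
  refine ⟨t, b, ?_, fun _ => rfl, ?_⟩
  · rintro x (rfl | ⟨v, hv, rfl⟩)
    · exact hsV hp
    · obtain ⟨y, hy, rfl⟩ := huV hv
      simpa using hy.1
  · have : q ∈ convexHull ℝ (range b) := convexHull_mono (hst.trans hb.ge) hqs
    rwa [b.convexHull_eq_nonneg_coord] at this

section Combination

variable {n m : ℕ} {P : Set (Fin n → ℝ)} {ι : Type*} [Fintype ι]

/-- A nonnegative combination of points of `P` of total weight `m` lies in `mP`. -/
lemma sum_smul_add_smul_mem_dilate (hm : 0 < m) (hP : Convex ℝ P) {p : ι → Fin n → ℝ}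
    (hp : ∀ i, p i ∈ P) {w : Fin n → ℝ} (hw : w ∈ P) {a : ι → ℝ} {c : ℝ} (ha : ∀ i, 0 ≤ a i)
    (hc : 0 ≤ c) (hsum : ∑ i, a i + c = m) :
    ∑ i, a i • p i + c • w ∈ dilate n m P := by
  have hm' : (0 : ℝ) < m := by exact_mod_cast hm
  have h := hP.sum_mem (t := Finset.univ) (w := fun o : Option ι => o.elim c a / m)
    (z := fun o => o.elim w p) (by
      rintro (_ | i) -
      exacts [div_nonneg hc hm'.le, div_nonneg (ha i) hm'.le])
    (by rw [← Finset.sum_div, Fintype.sum_option]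
        simp only [Option.elim]
        rw [add_comm, hsum, div_self hm'.ne'])
    (by rintro (_ | i) - <;> simp [hw, hp])
  refine ⟨_, h, ?_⟩
  simp only [Fintype.sum_option, Option.elim, smul_add, Finset.smul_sum, smul_smul,
    mul_div_cancel₀ _ hm'.ne']
  rw [add_comm]

/-- A combination of points of `P` of total weight `m` which is strictly positive at the vertices
of a full-dimensional simplex lies in the interior of `mP`. -/
lemma sum_smul_add_smul_mem_interior_dilate (hm : 0 < m) (hP : Convex ℝ P)
    (b : AffineBasis ι ℝ (Fin n → ℝ)) (hb : ∀ i, b i ∈ P) {w : Fin n → ℝ} (hw : w ∈ P)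
    {a : ι → ℝ} {c : ℝ} (ha : ∀ i, 0 < a i) (hc : 0 ≤ c) (hsum : ∑ i, a i + c = m) :
    ∑ i, a i • b i + c • w ∈ interior (dilate n m P) := by
  have hm' : (0 : ℝ) < m := by exact_mod_cast hm
  have : Nonempty ι := b.nonempty
  set A := ∑ i, a i with hA
  have hA0 : 0 < A := Finset.sum_pos (fun i _ => ha i) Finset.univ_nonempty
  have hA1 : ∑ i, a i / A = 1 := by rw [← Finset.sum_div, ← hA, div_self hA0.ne']
  have hs : ∑ i, (a i / A) • b i ∈ interior P := by
    refine interior_mono (convexHull_min (range_subset_iff.2 hb) hP) ?_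
    rw [b.interior_convexHull, ← Finset.univ.affineCombination_eq_linear_combination _ _ hA1]
    intro i
    rw [b.coord_apply_combination_of_mem (Finset.mem_univ i) hA1]
    exact div_pos (ha i) hA0
  have h := hP.combo_interior_closure_mem_interior hs (subset_closure hw) (div_pos hA0 hm')
    (div_nonneg hc hm'.le) (by rw [← add_div, hsum, div_self hm'.ne'])
  have hd : dilate n m P = (m : ℝ) • P := rfl
  rw [hd, interior_smul₀ hm'.ne']
  refine ⟨_, h, ?_⟩
  simp only [smul_add, smul_smul, Finset.smul_sum]
  congr 2
  · ext1 i
    field_simp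
  · field_simp

/-- If `w ∈ P` has two negative barycentric coordinates with respect to a simplex in `P`, then the
sum of the other vertices of the simplex lies in the interior of `(n-1)P`. -/
lemma sum_sub_sub_mem_interior_dilate (hn : 2 ≤ n) (hP : Convex ℝ P)
    (b : AffineBasis ι ℝ (Fin n → ℝ)) (hb : ∀ i, b i ∈ P) {w : Fin n → ℝ} (hw : w ∈ P) {o q : ι}
    (hoq : o ≠ q) (ho : b.coord o w < 0) (hq : b.coord q w < 0) :
    ∑ i, b i - b o - b q ∈ interior (dilate n (n - 1) P) := by
  classical
  have hδ (j : ι) : ∑ i, (if i = j then (1 : ℝ) else 0) • b i = b j := by simp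
  have hcard : (Fintype.card ι : ℝ) = n + 1 := by
    have := b.card_eq_finrank_add_one
    rw [Module.finrank_fin_fun] at this
    exact_mod_cast this
  have hβsum : ∑ i, b.coord i w = 1 := b.sum_coord_apply_eq_one w
  have hβw : ∑ i, b.coord i w • b i = w := b.linear_combination_coord_eq_self w
  set β : ι → ℝ := fun i => b.coord i w
  set M := ∑ i, |β i|
  have hMi (i : ι) : β i ≤ M :=
    (le_abs_self _).trans
      (Finset.single_le_sum (f := fun i => |β i|) (fun i _ => abs_nonneg _) (Finset.mem_univ i))
  have hM0 : 0 ≤ M := Finset.sum_nonneg fun i _ => abs_nonneg _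
  set t := 1 / (M + 1) with ht
  have ht0 : 0 < t := by positivity
  have h1 : ∑ i, b i - b o - b q =
      ∑ i, (1 - (if i = o then 1 else 0) - (if i = q then 1 else 0) - t * β i) • b i +
        t • w := by
    simp only [sub_smul, Finset.sum_sub_distrib, hδ, mul_smul, ← Finset.smul_sum, one_smul]
    rw [hβw, sub_add_cancel]
  rw [h1]
  refine sum_smul_add_smul_mem_interior_dilate (by omega) hP b hb hw (fun i => ?_) ht0.le ?_
  · have ho' : t * β o < 0 := mul_neg_of_pos_of_neg ht0 ho
    have hq' : t * β q < 0 := mul_neg_of_pos_of_neg ht0 hq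
    have hi : t * β i < 1 := by
      rw [ht, one_div_mul_eq_div, div_lt_one (by positivity)]
      linarith [hMi i]
    split_ifs with h h' h'
    · exact absurd (h.symm.trans h') hoq
    · subst h; linarith
    · subst h'; linarith
    · linarith
  · rw [Nat.cast_pred (by omega)]
    simp only [Finset.sum_sub_distrib, ← Finset.mul_sum]
    rw [hβsum]
    simp [hcard]

end Combination

/-- Subtracting a lattice point of `P` from a lattice point of `(k+1)P`, when the latter is
expressed in barycentric coordinates with respect to a lattice simplex in `P`. -/
lemma exists_sub_mem_dilate {n : ℕ} (hn : 3 ≤ n) {P : Set (Fin n → ℝ)} (hP : Convex ℝ P)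
    (huniq : (interior (dilate n (n - 1) P) ∩ lat n).Subsingleton)
    {ι : Type*} [Fintype ι] (b : AffineBasis ι ℝ (Fin n → ℝ)) (hbP : ∀ i, b i ∈ P)
    (hblat : ∀ i, b i ∈ lat n) {w : Fin n → ℝ} (hwP : w ∈ P) (hwlat : w ∈ lat n)
    (hwb : ∀ i, w ≠ b i) {k : ℕ} (hk : 1 ≤ k) {x : Fin n → ℝ} (hx : x ∈ lat n) {l : ι → ℝ}
    (hl : ∀ i, 0 ≤ l i) (hlsum : ∑ i, l i = k + 1) (hlx : ∑ i, l i • b i = x) :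
    ∃ v ∈ P ∩ lat n, x - v ∈ dilate n k P ∩ lat n := by
  classical
  have hadd {y z} (hy : y ∈ lat n) (hz : z ∈ lat n) : y + z ∈ lat n :=
    (latSubgroup n).add_mem hy hz
  have hsub {y z} (hy : y ∈ lat n) (hz : z ∈ lat n) : y - z ∈ lat n :=
    (latSubgroup n).sub_mem hy hz
  have hB : ∑ i, b i ∈ lat n := (latSubgroup n).sum_mem fun i _ => hblat i
  have hcard : (Fintype.card ι : ℝ) = n + 1 := by
    have := b.card_eq_finrank_add_one
    rw [Module.finrank_fin_fun] at this
    exact_mod_cast this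
  have hn1 : ((n - 1 : ℕ) : ℝ) = n - 1 := by push_cast [show 1 ≤ n by omega]; ring
  have hn0 : 0 < n - 1 := by omega
  have hδ (j : ι) : ∑ i, (if i = j then (1 : ℝ) else 0) • b i = b j := by simp
  have hmem {v : Fin n → ℝ} (hv : v ∈ P) {a : ι → ℝ} {c : ℝ} (ha : ∀ i, 0 < a i) (hc : 0 ≤ c)
      (hsum : ∑ i, a i + c = n - 1) (hlat : ∑ i, a i • b i + c • v ∈ lat n) :
      ∑ i, a i • b i + c • v ∈ interior (dilate n (n - 1) P) ∩ lat n :=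
    ⟨sum_smul_add_smul_mem_interior_dilate hn0 hP b hbP hv ha hc (hsum.trans hn1.symm), hlat⟩
  by_cases hl1 : ∃ i, 1 ≤ l i
  · obtain ⟨j, hj⟩ := hl1
    refine ⟨b j, ⟨hbP j, hblat j⟩, ?_, hsub hx (hblat j)⟩
    have := sum_smul_add_smul_mem_dilate hk hP hbP (hbP j) (c := 0)
      (a := fun i => l i - if i = j then 1 else 0)
      (fun i => by split_ifs with h <;> simp [hl, h, hj]) le_rfl
      (by simp [Finset.sum_sub_distrib, hlsum])
    simpa only [sub_smul, Finset.sum_sub_distrib, hδ, hlx, zero_smul, add_zero] using this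
  push Not at hl1
  have hι : Nonempty ι := b.nonempty
  -- the interior point complementary to `x`, translated along `v`
  have hcompl {v : Fin n → ℝ} (hvP : v ∈ P) (hvlat : v ∈ lat n) :
      ∑ i, b i - x + ((k : ℝ) - 1) • v ∈ interior (dilate n (n - 1) P) ∩ lat n := by
    have h1 : ∑ i, b i - x = ∑ i, (1 - l i) • b i := by
      simp [sub_smul, Finset.sum_sub_distrib, hlx]
    have hkv : ((k : ℝ) - 1) • v ∈ lat n := by
      have := (latSubgroup n).nsmul_mem hvlat (k - 1)
      rw [← Nat.cast_smul_eq_nsmul ℝ, Nat.cast_pred hk] at this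
      exact this
    rw [h1]
    refine hmem hvP (fun i => by linarith [hl1 i]) ?_ ?_ (h1 ▸ hadd (hsub hB hx) hkv)
    · have : (1 : ℝ) ≤ k := by exact_mod_cast hk
      linarith
    · simp [Finset.sum_sub_distrib, hlsum, hcard]
  obtain rfl | hk2 := hk.eq_or_lt
  swap
  · obtain ⟨i⟩ := hι
    have h := huniq (hcompl hwP hwlat) (hcompl (hbP i) (hblat i))
    have hk0 : (k : ℝ) - 1 ≠ 0 := by
      have : (1 : ℝ) < k := by exact_mod_cast hk2
      linarith
    exact absurd (smul_right_injective _ hk0 (add_left_cancel h)) (hwb i)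
  have hm₀ : ∑ i, b i - x ∈ interior (dilate n (n - 1) P) ∩ lat n := by
    simpa using hcompl hwP hwlat
  norm_num at hlsum
  set β : ι → ℝ := fun i => b.coord i w with hβ
  have hβsum : ∑ i, β i = 1 := b.sum_coord_apply_eq_one w
  have hβw : ∑ i, β i • b i = w := b.linear_combination_coord_eq_self w
  by_cases hle : ∀ i, β i ≤ l i
  · refine ⟨w, ⟨hwP, hwlat⟩, ?_, hsub hx hwlat⟩
    have := sum_smul_add_smul_mem_dilate one_pos hP hbP hwP (c := 0) (a := fun i => l i - β i)
      (fun i => sub_nonneg.2 (hle i)) le_rfl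
      (by simp [Finset.sum_sub_distrib, hlsum, hβsum]; norm_num)
    simpa only [sub_smul, Finset.sum_sub_distrib, hβw, hlx, zero_smul, add_zero] using this
  push Not at hle
  -- exchanging `b j` for `w` in the complementary interior point would give a second one
  have hexch (j : ι) (t : ℝ) (ht0 : 0 ≤ t) (ht1 : t ≤ 1) (hj : l j < t * β j)
      (ht : ∀ i, 0 < 1 - l i + t * β i) : False := by
    have h1 : ∑ i, b i - x + w - b j =
        ∑ i, (1 - l i + t * β i - if i = j then 1 else 0) • b i + (1 - t) • w := by
      simp only [sub_smul, add_smul, Finset.sum_sub_distrib, Finset.sum_add_distrib, hδ, hlx,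
        mul_smul, ← Finset.smul_sum, hβw, one_smul]
      abel
    have h2 : ∑ i, b i - x + w - b j ∈ interior (dilate n (n - 1) P) ∩ lat n := by
      rw [h1]
      refine hmem hwP ?_ (by linarith) ?_ (h1 ▸ hsub (hadd (hsub hB hx) hwlat) (hblat j))
      · intro i
        split_ifs with h
        · subst h; linarith
        · linarith [ht i]
      · simp only [Finset.sum_sub_distrib, Finset.sum_add_distrib, ← Finset.mul_sum, hlsum, hβsum]
        simp [hcard]
        ring
    have h3 := huniq hm₀ h2
    rw [add_sub_assoc, left_eq_add, sub_eq_zero] at h3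
    exact hwb j h3
  obtain ⟨j, hj⟩ := hle
  have hneg : ∃ i, β i < 0 := by
    by_contra! h
    exact hexch j 1 zero_le_one le_rfl (by simpa using hj) fun i => by linarith [h i, hl1 i]
  obtain ⟨o, ho⟩ := hneg
  have hnonneg : ∀ i, i ≠ o → 0 ≤ β i := by
    intro q hq
    by_contra! hβq
    have h2 := sum_sub_sub_mem_interior_dilate (by omega) hP b hbP hwP hq.symm ho hβq
    have h3 := huniq hm₀ ⟨h2, hsub (hsub hB (hblat o)) (hblat q)⟩
    have h4 : ∑ i, (l i - (if i = o then 1 else 0) - (if i = q then 1 else 0)) • b i = 0 := by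
      simp only [sub_smul, Finset.sum_sub_distrib, hδ, hlx]
      rw [sub_sub, sub_right_inj] at h3
      rw [h3]
      abel
    have h5 := (affineIndependent_iff.1 b.ind) Finset.univ _
      (by simp [Finset.sum_sub_distrib, hlsum]; norm_num) h4 o (Finset.mem_univ o)
    simp only [if_true, hq.symm, if_false] at h5
    linarith [hl1 o]
  have hbound (i : ι) (hi : l i < β i) : β i * (1 - l o) ≤ l i * -β o := by
    by_contra! h
    have hβi : 0 < β i := (hl i).trans_lt hi
    obtain ⟨t, ht1, ht2⟩ : ∃ t, l i / β i < t ∧ t < min 1 ((1 - l o) / -β o) := by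
      refine exists_between (lt_min ((div_lt_one hβi).2 hi) ?_)
      rw [div_lt_div_iff₀ hβi (by linarith)]
      linarith
    rw [lt_min_iff, lt_div_iff₀ (by linarith)] at ht2
    have ht0 : 0 ≤ t := (div_nonneg (hl i) hβi.le).trans ht1.le
    refine hexch i t ht0 ht2.1.le ((div_lt_iff₀ hβi).1 ht1) fun q => ?_
    by_cases hq : q = o
    · subst hq; linarith [ht2.2]
    · have := mul_nonneg ht0 (hnonneg q hq)
      linarith [hl1 q]
  -- `x - b o` lies in the convex hull of the simplex and `w`
  set t := (1 - l o) / -β o with ht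
  have ho' : 0 < -β o := by linarith
  have ht0 : 0 ≤ t := div_nonneg (by linarith [hl1 o]) ho'.le
  have hto : t * β o = l o - 1 := by rw [ht]; field_simp [ho.ne]; ring
  have htj (i : ι) (hi : l i < β i) : t * β i ≤ l i := by
    rw [ht, div_mul_eq_mul_div, div_le_iff₀ ho']
    linarith [hbound i hi]
  have ht1 : t ≤ 1 := by
    have := htj j hj
    nlinarith [hl j]
  refine ⟨b o, ⟨hbP o, hblat o⟩, ?_, hsub hx (hblat o)⟩
  have := sum_smul_add_smul_mem_dilate one_pos hP hbP hwP (c := t)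
    (a := fun i => l i - t * β i - if i = o then 1 else 0)
    (fun i => by
      split_ifs with h
      · subst h; linarith
      · by_cases hi : l i < β i
        · linarith [htj i hi]
        · nlinarith [hnonneg i h]) ht0
    (by simp [Finset.sum_sub_distrib, ← Finset.mul_sum, hlsum, hβsum]; ring)
  convert this using 1
  simp only [sub_smul, Finset.sum_sub_distrib, hδ, hlx, mul_smul, ← Finset.smul_sum, hβw]
  abel

/-- For `n ≥ 3`, a lattice `n`-polytope with at least `n+2` lattice points and exactly
one lattice point in the interior of `(n-1)P` is normal. -/
theorem normal_of_many_lattice_points (n : ℕ) (hn : 3 ≤ n) (P : Set (Fin n → ℝ))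
    (hP : IsLatticePolytope n P)
    (hcard : n + 2 ≤ (P ∩ lat n).ncard)
    (hint : ∃ m₀, interior (dilate n (n - 1) P) ∩ lat n = {m₀}) :
    ∀ k : ℕ, 1 ≤ k →
      (dilate n k P ∩ lat n) + (P ∩ lat n) = dilate n (k + 1) P ∩ lat n := by
  obtain ⟨⟨S, -, hS⟩, hspan⟩ := hP
  obtain ⟨m₀, hm₀⟩ := hint
  set V : Set (Fin n → ℝ) :=
    (fun m : Fin n → ℤ => fun i => (m i : ℝ)) '' (S : Set (Fin n → ℤ)) with hV
  have hconv : Convex ℝ P := hS ▸ convex_convexHull ℝ V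
  have hVP : V ⊆ P := hS ▸ subset_convexHull ℝ V
  have hVlat : V ⊆ lat n := by
    rintro _ ⟨m, -, rfl⟩ i
    exact ⟨m i, rfl⟩
  have hVspan : affineSpan ℝ V = ⊤ := by rwa [hS, affineSpan_convexHull] at hspan
  intro k hk
  have hk0 : (0 : ℝ) < k + 1 := by positivity
  apply Subset.antisymm
  · rintro _ ⟨_, ⟨⟨y, hy, rfl⟩, hylat⟩, v, ⟨hv, hvlat⟩, rfl⟩
    refine ⟨?_, (latSubgroup n).add_mem hylat hvlat⟩
    have := sum_smul_add_smul_mem_dilate (m := k + 1) (by omega) hconv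
      (fun _ : Unit => hy) hv (a := fun _ => (k : ℝ)) (c := 1) (fun _ => by positivity)
      zero_le_one (by simp)
    simpa using this
  · rintro _ ⟨⟨q, hq, rfl⟩, hxlat⟩
    obtain ⟨t, b, htV, hbt, hbq⟩ :=
      exists_affineBasis_subset_of_mem_convexHull hVspan (hS ▸ hq)
    have : Finite t := ((S.finite_toSet.image _).subset htV).to_subtype
    have : Fintype t := Fintype.ofFinite t
    have hbV (i : t) : b i ∈ V := hbt i ▸ htV i.2
    have htcard : t.ncard = n + 1 := by
      rw [← Nat.card_coe_set_eq, Nat.card_eq_fintype_card, b.card_eq_finrank_add_one,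
        Module.finrank_fin_fun]
    obtain ⟨w, ⟨hwP, hwlat⟩, hwt⟩ :=
      exists_mem_notMem_of_ncard_lt_ncard (s := t) (t := P ∩ lat n) (by omega) (toFinite t)
    obtain ⟨v, hv, hxv⟩ := exists_sub_mem_dilate hn hconv (hm₀ ▸ subsingleton_singleton) b
      (fun i => hVP (hbV i)) (fun i => hVlat (hbV i)) hwP hwlat
      (fun i h => hwt (h ▸ hbt i ▸ i.2)) hk hxlat (l := fun i => (k + 1) * b.coord i q)
      (fun i => mul_nonneg hk0.le (hbq i))
      (by rw [← Finset.mul_sum, b.sum_coord_apply_eq_one, mul_one])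
      (by simp only [mul_smul, ← Finset.smul_sum, b.linear_combination_coord_eq_self]
          push_cast; rfl)
    exact ⟨_, hxv, v, hv, sub_add_cancel _ _⟩
end
end

section
/- Let n ≥ 3 and let P ⊆ ℝⁿ be a lattice n-polytope such that the topological interior of the dilate (n−2)P contains no point of ℤⁿ. Let g be the number of points of ℤⁿ in the topological interior of (n−1)P. If P ∩ ℤⁿ has at least n + g + 1 elements, then P is normal: for every integer k ≥ 1, (kP) ∩ ℤⁿ + P ∩ ℤⁿ = ((k+1)P) ∩ ℤⁿ. -/
open Set Pointwise

noncomputable section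

/-- Over a domain, a set of basis vectors on which a coordinate of the product vanishes
has at most half of the elements of the basis. -/
theorem two_mul_card_le_of_isotropic {S R ι : Type*} [CommRing S] [IsDomain S] [CommRing R]
    [IsDomain R] [Algebra S R] [Fintype ι] [DecidableEq ι] (X : ι → R)
    (hX : LinearIndependent S X) (p : ι → ι → ι → S)
    (hp : ∀ i j, X i * X j = ∑ k, p i j k • X k) (V : Finset ι) (x : ι)
    (h : ∀ i ∈ V, ∀ j ∈ V, p i j x = 0) : 2 * V.card ≤ Fintype.card ι := by
  classical
  by_contra! hlt
  have hcard : Fintype.card (Vᶜ : Finset ι) < Fintype.card V := by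
    simp only [Fintype.card_coe, Finset.card_compl]
    have := Finset.card_le_univ V
    omega
  let F : (V → S) →ₗ[S] ((Vᶜ : Finset ι) → S) :=
    LinearMap.pi fun j => ∑ i : V, (p i j x) • LinearMap.proj i
  obtain ⟨c, hc0, hc⟩ : ∃ c : V → S, c ≠ 0 ∧ F c = 0 := by
    by_contra! hinj
    have : Function.Injective F := by
      rw [← LinearMap.ker_eq_bot, LinearMap.ker_eq_bot']
      intro m hm
      by_contra hne
      exact hinj m hne hm
    have := card_le_of_injective S F this
    omega
  set a : R := ∑ i : V, c i • X i with ha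
  have ha0 : a ≠ 0 := by
    intro h0
    have hli : LinearIndependent S (fun i : V => X i) := hX.comp _ Subtype.val_injective
    exact hc0 (funext (Fintype.linearIndependent_iff.1 hli c h0))
  let P : Matrix ι ι S := fun j k => ∑ i : V, c i * p i j k
  have hP : ∀ j, a * X j = ∑ k, P j k • X k := by
    intro j
    simp only [ha, Finset.sum_mul, smul_mul_assoc, hp, P, Finset.smul_sum, Finset.sum_smul,
      smul_smul]
    rw [Finset.sum_comm]
  have hcol : ∀ j, P j x = 0 := by
    intro j
    by_cases hj : j ∈ V
    · exact Finset.sum_eq_zero fun i _ => by rw [h i i.2 j hj, mul_zero]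
    · have := congrFun hc ⟨j, Finset.mem_compl.2 hj⟩
      simpa [F, P, mul_comm] using this
  have hdet : P.det = 0 := Matrix.det_eq_zero_of_column_eq_zero x hcol
  obtain ⟨w, hw0, hw⟩ := Matrix.exists_vecMul_eq_zero_iff.2 hdet
  have hz : a * ∑ j, w j • X j = 0 := by
    have : a * ∑ j, w j • X j = ∑ k, (Matrix.vecMul w P) k • X k := by
      simp only [Finset.mul_sum, mul_smul_comm, hP, Matrix.vecMul, dotProduct, Finset.sum_smul,
        Finset.smul_sum, smul_smul]
      rw [Finset.sum_comm]
    rw [this, hw]; simp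
  rcases mul_eq_zero.1 hz with h0 | h0
  · exact ha0 h0
  · exact hw0 (funext (Fintype.linearIndependent_iff.1 hX w h0))

/-- A positive integral point at which finitely many nonzero linear forms do not vanish. -/
theorem exists_generic {α : Type*} (Q : Finset α) (F : Finset (α → ℤ))
    (hF : ∀ f ∈ F, ∃ v ∈ Q, f v ≠ 0) :
    ∃ κ : α → ℕ, (∀ v, 0 < κ v) ∧ ∀ f ∈ F, ∑ v ∈ Q, (κ v : ℤ) * f v ≠ 0 := by
  classical
  let p : MvPolynomial α ℤ := ∏ f ∈ F, ∑ v ∈ Q, MvPolynomial.C (f v) * MvPolynomial.X v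
  have hp : p ≠ 0 := by
    refine Finset.prod_ne_zero_iff.2 fun f hf h0 => ?_
    obtain ⟨v, hv, hfv⟩ := hF f hf
    apply hfv
    have := congrArg (MvPolynomial.eval (Pi.single v (1 : ℤ))) h0
    simpa [Pi.single_apply, Finset.sum_ite_eq, hv] using this
  by_contra! hcon
  apply hp
  refine MvPolynomial.funext_set (fun _ => Set.Ioi (0 : ℤ)) (fun _ => Set.Ioi_infinite 0) ?_
  intro x hx
  obtain ⟨f, hf, h0⟩ := hcon (fun v => (x v).toNat) (fun v => by
    have := hx v (Set.mem_univ v); simp at this; simpa using this)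
  simp only [p, map_prod, map_sum, map_mul, MvPolynomial.eval_C, MvPolynomial.eval_X, map_zero]
  refine Finset.prod_eq_zero hf ?_
  rw [← h0]
  refine Finset.sum_congr rfl fun v _ => ?_
  have := hx v (Set.mem_univ v)
  simp only [Set.mem_Ioi] at this
  rw [Int.toNat_of_nonneg this.le, mul_comm]

/-- The real vector underlying an integral vector. -/
def toReal {d : ℕ} (m : Fin d → ℤ) : Fin d → ℝ := fun i => (m i : ℝ)

theorem toReal_injective {d : ℕ} : Function.Injective (toReal (d := d)) := fun a b h => by
  funext i
  have := congrFun h i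
  exact Int.cast_injective this

/-- `c` consists of the coordinate functionals of the basis `T`, multiplied by `N > 0`. -/
structure IsDual {d : ℕ} (T : Finset (Fin d → ℤ)) (N : ℤ)
    (c : (Fin d → ℤ) → (Fin d → ℤ) →+ ℤ) : Prop where
  pos : 0 < N
  expand : ∀ m, N • m = ∑ v ∈ T, c v m • v
  delta : ∀ u ∈ T, ∀ v ∈ T, c v u = if u = v then N else 0
  card_eq : T.card = d

theorem exists_real_extension {d : ℕ} (f : (Fin d → ℤ) →+ ℤ) :
    ∃ F : (Fin d → ℝ) →ₗ[ℝ] ℝ, ∀ m, F (toReal m) = f m := by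
  refine ⟨∑ j, (f (Pi.single j 1) : ℝ) • LinearMap.proj j, fun m => ?_⟩
  have : m = ∑ j, m j • (Pi.single j (1 : ℤ) : Fin d → ℤ) := by
    funext i
    simp [Finset.sum_apply, Pi.single_apply]
  conv_rhs => rw [this]
  rw [map_sum]
  simp only [map_zsmul, LinearMap.sum_apply, LinearMap.smul_apply, LinearMap.proj_apply, toReal,
    smul_eq_mul, Int.cast_sum, Int.cast_mul]
  exact Finset.sum_congr rfl fun i _ => mul_comm _ _

/-- A rational basis consisting of integral vectors has scaled dual coordinates. -/
theorem exists_isDual {d : ℕ} (T : Finset (Fin d → ℤ))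
    (hli : LinearIndepOn ℝ toReal (T : Set (Fin d → ℤ)))
    (hspan : Submodule.span ℝ (toReal '' (T : Set (Fin d → ℤ))) = ⊤) :
    ∃ N c, IsDual T N c := by
  classical
  have hli' : LinearIndependent ℝ (fun v : T => toReal (v : Fin d → ℤ)) := hli
  have hsp : ⊤ ≤ Submodule.span ℝ (Set.range fun v : T => toReal (v : Fin d → ℤ)) := by
    rw [← hspan]
    apply Submodule.span_mono
    rintro _ ⟨v, hv, rfl⟩
    exact ⟨⟨v, hv⟩, rfl⟩
  let b := Module.Basis.mk hli' hsp
  have hcard : Fintype.card T = Fintype.card (Fin d) := by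
    rw [← Module.finrank_eq_card_basis b]; simp
  let e : T ≃ Fin d := Fintype.equivOfCardEq hcard
  let A : Matrix (Fin d) (Fin d) ℤ := fun i j => (e.symm j : Fin d → ℤ) i
  have hdet : A.det ≠ 0 := by
    intro h0
    obtain ⟨w, hw0, hw⟩ := Matrix.exists_mulVec_eq_zero_iff.2 h0
    apply hw0
    have key : ∑ v : T, (w (e v) : ℝ) • toReal (v : Fin d → ℤ) = 0 := by
      rw [← e.symm.sum_comp]
      funext i
      have := congrFun hw i
      simp only [Matrix.mulVec, dotProduct, Pi.zero_apply, A] at this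
      have h2 := congrArg (Int.cast : ℤ → ℝ) this
      push_cast at h2
      simpa [toReal, mul_comm] using h2
    have := Fintype.linearIndependent_iff.1 hli' (fun v => (w (e v) : ℝ)) key
    funext j
    have := this (e.symm j)
    simpa using this
  let c' : T → (Fin d → ℤ) →+ ℤ := fun v =>
    { toFun := fun m => A.det * (A.adjugate.mulVec m) (e v)
      map_zero' := by simp
      map_add' := fun a b => by simp [Matrix.mulVec_add, mul_add] }
  refine ⟨A.det * A.det, fun v => if h : v ∈ T then c' ⟨v, h⟩ else 0, ?_, ?_, ?_,
    by simpa using hcard⟩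
  · exact mul_self_pos.2 hdet
  · intro m
    have h1 : A.mulVec (A.adjugate.mulVec m) = A.det • m := by
      rw [Matrix.mulVec_mulVec, Matrix.mul_adjugate, Matrix.smul_mulVec, Matrix.one_mulVec]
    rw [← Finset.sum_coe_sort T]
    simp only [Finset.coe_mem, dif_pos]
    rw [mul_smul, ← h1, ← e.symm.sum_comp]
    funext i
    simp [c', A, Matrix.mulVec, dotProduct, Finset.mul_sum, mul_comm, mul_left_comm, mul_assoc]
  · intro u hu v hv
    simp only [hv, dif_pos, c', AddMonoidHom.coe_mk, ZeroHom.coe_mk]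
    have h1 : A.mulVec (Pi.single (e ⟨u, hu⟩) 1) = u := by
      rw [Matrix.mulVec_single_one]
      funext i
      simp [A, Matrix.col, Matrix.transpose]
    have h2 : A.adjugate.mulVec u = A.det • Pi.single (e ⟨u, hu⟩) 1 := by
      conv_lhs => rw [← h1]
      rw [Matrix.mulVec_mulVec, Matrix.adjugate_mul, Matrix.smul_mulVec, Matrix.one_mulVec]
    rw [h2]
    by_cases huv : u = v
    · subst huv; simp
    · have : e ⟨v, hv⟩ ≠ e ⟨u, hu⟩ := fun h => huv (by simpa using (e.injective h).symm)
      simp [huv, this]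

/-- A nonnegative combination of points at height one can be rewritten, without increasing its
cost, with a linearly independent support. -/
theorem exists_linearIndepOn_support {d : ℕ} (Q : Finset (Fin d → ℤ)) (h : (Fin d → ℤ) →+ ℤ)
    (hQ : ∀ v ∈ Q, h v = 1) (κ : (Fin d → ℤ) → ℕ) (z : Fin d → ℝ) (ρ : (Fin d → ℤ) → ℝ)
    (hρ : ∀ v, 0 ≤ ρ v) (hz : z = ∑ v ∈ Q, ρ v • toReal v) :
    ∃ ρ' : (Fin d → ℤ) → ℝ, (∀ v, 0 ≤ ρ' v) ∧ z = ∑ v ∈ Q, ρ' v • toReal v ∧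
      ∑ v ∈ Q, ρ' v * κ v ≤ ∑ v ∈ Q, ρ v * κ v ∧
      LinearIndepOn ℝ toReal ({v | v ∈ Q ∧ ρ' v ≠ 0} : Set (Fin d → ℤ)) := by
  classical
  induction hk : (Q.filter fun v => ρ v ≠ 0).card using Nat.strong_induction_on generalizing ρ with
  | _ k ih =>
  by_cases hli : LinearIndepOn ℝ toReal ({v | v ∈ Q ∧ ρ v ≠ 0} : Set (Fin d → ℤ))
  · exact ⟨ρ, hρ, hz, le_rfl, hli⟩
  set s := Q.filter fun v => ρ v ≠ 0 with hs
  have hs' : ({v | v ∈ Q ∧ ρ v ≠ 0} : Set (Fin d → ℤ)) = (s : Set (Fin d → ℤ)) := by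
    ext; simp [hs]
  rw [hs', linearIndepOn_finset_iff] at hli
  push Not at hli
  obtain ⟨a₀, ha₀, hne₀⟩ := hli
  obtain ⟨a, ha, hne, hcost⟩ : ∃ a : (Fin d → ℤ) → ℝ, ∑ v ∈ s, a v • toReal v = 0 ∧
      (∃ v ∈ s, a v ≠ 0) ∧ 0 ≤ ∑ v ∈ s, a v * κ v := by
    rcases le_total 0 (∑ v ∈ s, a₀ v * κ v) with h0 | h0
    · exact ⟨a₀, ha₀, hne₀, h0⟩
    · refine ⟨-a₀, by simp [ha₀], by simpa using hne₀, ?_⟩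
      simpa using h0
  have hlev : ∑ v ∈ s, a v = 0 := by
    obtain ⟨H, hH⟩ := exists_real_extension h
    have := congrArg H ha
    simp only [map_sum, map_smul, hH, map_zero, smul_eq_mul] at this
    rw [← this]
    refine Finset.sum_congr rfl fun v hv => ?_
    rw [hQ v (Finset.filter_subset _ _ hv)]; simp
  obtain ⟨u₀, hu₀, hpos₀⟩ : ∃ v ∈ s, 0 < a v := by
    by_contra! hle
    obtain ⟨v, hv, hv0⟩ := hne
    exact hv0 ((Finset.sum_eq_zero_iff_of_nonpos hle).1 hlev v hv)
  obtain ⟨u, hu, hmin⟩ := Finset.exists_min_image (s.filter fun v => 0 < a v)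
    (fun v => ρ v / a v) ⟨u₀, by simp [hu₀, hpos₀]⟩
  rw [Finset.mem_filter] at hu
  obtain ⟨hus, hua⟩ := hu
  set t := ρ u / a u with ht
  have ht0 : 0 ≤ t := div_nonneg (hρ u) hua.le
  let ρ₁ : (Fin d → ℤ) → ℝ := fun v => if v ∈ s then ρ v - t * a v else 0
  have hsQ : s ⊆ Q := Finset.filter_subset _ _
  have hoff : ∀ v ∈ Q, v ∉ s → ρ v = 0 := by
    intro v hv hvs
    by_contra h0
    exact hvs (Finset.mem_filter.2 ⟨hv, h0⟩)
  have hsumQ : ∀ (f : (Fin d → ℤ) → ℝ), ∑ v ∈ Q, ρ v * f v = ∑ v ∈ s, ρ v * f v := fun f =>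
    (Finset.sum_subset hsQ fun v hv hvs => by simp [hoff v hv hvs]).symm
  have hρ₁ : ∀ v, 0 ≤ ρ₁ v := by
    intro v
    simp only [ρ₁]
    split_ifs with hv
    · rcases le_or_gt (a v) 0 with hav | hav
      · nlinarith [hρ v, mul_nonneg ht0 (neg_nonneg.2 hav)]
      · have := hmin v (by simp [hv, hav])
        have := (le_div_iff₀ hav).1 this
        linarith
    · exact le_rfl
  have hz₁ : z = ∑ v ∈ Q, ρ₁ v • toReal v := by
    rw [hz, ← Finset.sum_subset hsQ (f := fun v => ρ v • toReal v) fun v hv hvs => by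
        simp [hoff v hv hvs],
      ← Finset.sum_subset hsQ (f := fun v => ρ₁ v • toReal v) fun v hv hvs => by
        simp [ρ₁, hvs]]
    have : ∑ v ∈ s, ρ₁ v • toReal v = ∑ v ∈ s, (ρ v • toReal v - t • (a v • toReal v)) := by
      refine Finset.sum_congr rfl fun v hv => ?_
      simp [ρ₁, hv, sub_smul, mul_smul]
    rw [this, Finset.sum_sub_distrib, ← Finset.smul_sum, ha]; simp
  have hcost₁ : ∑ v ∈ Q, ρ₁ v * κ v ≤ ∑ v ∈ Q, ρ v * κ v := by
    rw [hsumQ, ← Finset.sum_subset hsQ (f := fun v => ρ₁ v * κ v) fun v hv hvs => by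
        simp [ρ₁, hvs]]
    have : ∑ v ∈ s, ρ₁ v * κ v = ∑ v ∈ s, (ρ v * κ v - t * (a v * κ v)) := by
      refine Finset.sum_congr rfl fun v hv => ?_
      simp only [ρ₁, hv, if_true]; ring
    rw [this, Finset.sum_sub_distrib, ← Finset.mul_sum]
    have := mul_nonneg ht0 hcost
    linarith
  have hlt : (Q.filter fun v => ρ₁ v ≠ 0).card < k := by
    rw [← hk]
    refine Finset.card_lt_card ⟨fun v hv => ?_, fun hsub => ?_⟩
    · rw [Finset.mem_filter] at hv
      by_contra hvs
      exact hv.2 (by simp [ρ₁, hvs])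
    · have := (Finset.mem_filter.1 (hsub hus)).2
      apply this
      simp only [ρ₁, hus, if_true, ht]
      field_simp
      ring
  obtain ⟨ρ₂, h1, h2, h3, h4⟩ := ih _ hlt ρ₁ hρ₁ hz₁ rfl
  exact ⟨ρ₂, h1, h2, h3.trans hcost₁, h4⟩

namespace IsDual

variable {d : ℕ} {T : Finset (Fin d → ℤ)} {N : ℤ} {c : (Fin d → ℤ) → (Fin d → ℤ) →+ ℤ}

theorem smul (hT : IsDual T N c) {k : ℤ} (hk : 0 < k) :
    IsDual T (k * N) (fun v => k • c v) where
  pos := mul_pos hk hT.pos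
  expand m := by
    simp only [AddMonoidHom.smul_apply, smul_assoc]
    rw [mul_smul, hT.expand, Finset.smul_sum]
  delta u hu v hv := by
    rw [AddMonoidHom.smul_apply, hT.delta u hu v hv]
    split_ifs <;> simp
  card_eq := hT.card_eq

theorem map_expand (hT : IsDual T N c) (g : (Fin d → ℤ) →+ ℤ) (m : Fin d → ℤ) :
    N * g m = ∑ v ∈ T, c v m * g v := by
  have := congrArg g (hT.expand m)
  simpa only [map_sum, map_zsmul, smul_eq_mul] using this

theorem expand_real (hT : IsDual T N c) (m : Fin d → ℤ) :
    (N : ℝ) • toReal m = ∑ v ∈ T, (c v m : ℝ) • toReal v := by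
  funext i
  have := congrArg (Int.cast : ℤ → ℝ) (congrFun (hT.expand m) i)
  simpa [toReal] using this

theorem ext_of_coord (hT : IsDual T N c) {x y : Fin d → ℤ} (h : ∀ v ∈ T, c v x = c v y) :
    x = y := by
  have : N • x = N • y := by
    rw [hT.expand, hT.expand]
    exact Finset.sum_congr rfl fun v hv => by rw [h v hv]
  exact smul_right_injective _ hT.pos.ne' this

theorem coord_eq (hT : IsDual T N c) {z : Fin d → ℤ} {ρ : (Fin d → ℤ) → ℝ}
    (hz : toReal z = ∑ u ∈ T, ρ u • toReal u) {v : Fin d → ℤ} (hv : v ∈ T) :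
    (c v z : ℝ) = N * ρ v := by
  obtain ⟨F, hF⟩ := exists_real_extension (c v)
  rw [← hF, hz, map_sum]
  simp only [map_smul, hF, smul_eq_mul]
  rw [Finset.sum_eq_single v]
  · rw [hT.delta v hv v hv, if_pos rfl, mul_comm]
  · intro u hu huv
    rw [hT.delta u hu v hv, if_neg huv]; simp
  · exact fun h => absurd hv h

end IsDual

/-- The linear function equal to `N * κ` on the basis `T`. -/
def heightHom {d : ℕ} (κ : (Fin d → ℤ) → ℕ) (T : Finset (Fin d → ℤ))
    (c : (Fin d → ℤ) → (Fin d → ℤ) →+ ℤ) : (Fin d → ℤ) →+ ℤ :=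
  ∑ v ∈ T, (κ v : ℤ) • c v

theorem heightHom_apply {d : ℕ} (κ : (Fin d → ℤ) → ℕ) (T : Finset (Fin d → ℤ))
    (c : (Fin d → ℤ) → (Fin d → ℤ) →+ ℤ) (m : Fin d → ℤ) :
    heightHom κ T c m = ∑ v ∈ T, (κ v : ℤ) * c v m := by
  simp [heightHom, AddMonoidHom.finsetSum_apply]

theorem heightHom_mem {d : ℕ} {κ : (Fin d → ℤ) → ℕ} {T : Finset (Fin d → ℤ)} {N : ℤ}
    {c : (Fin d → ℤ) → (Fin d → ℤ) →+ ℤ} (hT : IsDual T N c) {v : Fin d → ℤ} (hv : v ∈ T) :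
    heightHom κ T c v = N * κ v := by
  rw [heightHom_apply, Finset.sum_eq_single v]
  · rw [hT.delta v hv v hv, if_pos rfl, mul_comm]
  · intro u hu huv
    rw [hT.delta v hv u hu, if_neg huv.symm]; simp
  · exact fun h => absurd hv h

/-- The integral points of the cone generated by `Q`. -/
def InCone {d : ℕ} (Q : Finset (Fin d → ℤ)) (m : Fin d → ℤ) : Prop :=
  ∃ ρ : (Fin d → ℤ) → ℝ, (∀ v, 0 ≤ ρ v) ∧ toReal m = ∑ v ∈ Q, ρ v • toReal v

/-- `x + ε q` has positive coordinates for small `ε > 0`. -/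
def Pos {d : ℕ} (T : Finset (Fin d → ℤ)) (c : (Fin d → ℤ) → (Fin d → ℤ) →+ ℤ)
    (q x : Fin d → ℤ) : Prop :=
  ∀ v ∈ T, 0 < c v x ∨ (c v x = 0 ∧ 0 < c v q)

/-- A regular triangulation, with heights `κ`, of the cone generated by `Q`, together with a
point `q` in general position. -/
structure IsTriangulation {d : ℕ} (Q : Finset (Fin d → ℤ)) (N : ℤ) (κ : (Fin d → ℤ) → ℕ)
    (Δ : Finset (Finset (Fin d → ℤ)))
    (c : Finset (Fin d → ℤ) → (Fin d → ℤ) → (Fin d → ℤ) →+ ℤ) (q : Fin d → ℤ) : Prop where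
  dual : ∀ T ∈ Δ, IsDual T N (c T)
  subset : ∀ T ∈ Δ, T ⊆ Q
  κ_pos : ∀ v, 0 < κ v
  q_eq : q = ∑ v ∈ Q, κ v • v
  generic : ∀ T ∈ Δ, ∀ v ∈ T, c T v q ≠ 0
  lt_height : ∀ T ∈ Δ, ∀ w ∈ Q, w ∉ T → heightHom κ T (c T) w < N * κ w
  exists_pos : ∀ x, InCone Q x → ∃ T ∈ Δ, Pos T (c T) q x

/-- Linear programming: a nonnegative combination can be replaced by one supported on a basis,
without increasing its cost. -/
theorem exists_basis_le {d : ℕ} {Q : Finset (Fin d → ℤ)} {h : (Fin d → ℤ) →+ ℤ}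
    (hQ : ∀ v ∈ Q, h v = 1)
    (hspan : Submodule.span ℝ (toReal '' (Q : Set (Fin d → ℤ))) = ⊤)
    {N : ℤ} {c : Finset (Fin d → ℤ) → (Fin d → ℤ) → (Fin d → ℤ) →+ ℤ}
    {Bs : Finset (Finset (Fin d → ℤ))}
    (hBs : ∀ T ⊆ Q, (∃ N c, IsDual T N c) → T ∈ Bs)
    (hdual : ∀ T ∈ Bs, IsDual T N (c T)) (κ : (Fin d → ℤ) → ℕ) (z : Fin d → ℤ)
    (ρ : (Fin d → ℤ) → ℝ) (hρ : ∀ v, 0 ≤ ρ v) (hz : toReal z = ∑ v ∈ Q, ρ v • toReal v) :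
    ∃ T ∈ Bs, (∀ v ∈ T, 0 ≤ c T v z) ∧
      (heightHom κ T (c T) z : ℝ) ≤ N * ∑ v ∈ Q, ρ v * κ v := by
  classical
  obtain ⟨ρ', hρ', hz', hcost, hli⟩ :=
    exists_linearIndepOn_support Q h hQ κ (toReal z) ρ hρ hz
  obtain ⟨b, hbQ, hsb, hb, hbli⟩ := exists_linearIndepOn_extension hli
    (t := (Q : Set (Fin d → ℤ))) (fun v hv => hv.1)
  obtain ⟨T, rfl⟩ : ∃ T : Finset (Fin d → ℤ), (T : Set (Fin d → ℤ)) = b :=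
    ⟨(Q.finite_toSet.subset hbQ).toFinset, by simp⟩
  have hTQ : T ⊆ Q := by exact_mod_cast hbQ
  have hTspan : Submodule.span ℝ (toReal '' (T : Set (Fin d → ℤ))) = ⊤ := by
    rw [eq_top_iff, ← hspan, Submodule.span_le]
    exact hb
  have hT := hBs T hTQ (exists_isDual T hbli hTspan)
  have hoff : ∀ v ∈ Q, v ∉ T → ρ' v = 0 := fun v hv hvT => by
    by_contra h0
    exact hvT (hsb ⟨hv, h0⟩)
  rw [← Finset.sum_subset hTQ fun v hv hvT => by simp [hoff v hv hvT]] at hz'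
  have hcoord := fun v (hv : v ∈ T) => (hdual T hT).coord_eq hz' hv
  have hN : (0 : ℝ) < N := by exact_mod_cast (hdual T hT).pos
  refine ⟨T, hT, fun v hv => ?_, ?_⟩
  · have : (0 : ℝ) ≤ c T v z := by rw [hcoord v hv]; exact mul_nonneg hN.le (hρ' v)
    exact_mod_cast this
  · refine le_trans (le_of_eq ?_) (mul_le_mul_of_nonneg_left hcost hN.le)
    rw [← Finset.sum_subset hTQ fun v hv hvT => by simp [hoff v hv hvT], heightHom_apply,
      Finset.mul_sum]
    push_cast
    exact Finset.sum_congr rfl fun v hv => by rw [hcoord v hv]; ring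

theorem exists_isTriangulation {d : ℕ} {Q : Finset (Fin d → ℤ)} {h : (Fin d → ℤ) →+ ℤ}
    (hQ : ∀ v ∈ Q, h v = 1)
    (hspan : Submodule.span ℝ (toReal '' (Q : Set (Fin d → ℤ))) = ⊤) :
    ∃ N κ Δ c q, IsTriangulation Q N κ Δ c q := by
  classical
  let Bs : Finset (Finset (Fin d → ℤ)) :=
    Q.powerset.filter fun T => ∃ N c, IsDual T N c
  have hmem : ∀ T, T ∈ Bs ↔ T ⊆ Q ∧ ∃ N c, IsDual T N c := fun T => by simp [Bs]
  have hex : ∀ T, ∃ N c, T ∈ Bs → IsDual T N c := fun T => by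
    by_cases hT : T ∈ Bs
    · obtain ⟨N, c, h⟩ := ((hmem T).1 hT).2
      exact ⟨N, c, fun _ => h⟩
    · exact ⟨0, 0, fun h => absurd h hT⟩
  choose N₀ c₀ hdual₀ using hex
  let N : ℤ := ∏ T ∈ Bs, N₀ T
  let c : Finset (Fin d → ℤ) → (Fin d → ℤ) → (Fin d → ℤ) →+ ℤ :=
    fun T v => (∏ T' ∈ Bs.erase T, N₀ T') • c₀ T v
  have hdual : ∀ T ∈ Bs, IsDual T N (c T) := fun T hT => by
    have := (hdual₀ T hT).smul (k := ∏ T' ∈ Bs.erase T, N₀ T')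
      (Finset.prod_pos fun T' hT' => (hdual₀ T' (Finset.mem_of_mem_erase hT')).pos)
    rwa [Finset.prod_erase_mul _ _ hT] at this
  have hsub : ∀ T ∈ Bs, T ⊆ Q := fun T hT => ((hmem T).1 hT).1
  let f₁ : Finset (Fin d → ℤ) → (Fin d → ℤ) → (Fin d → ℤ) → ℤ := fun T u v => c T u v
  let f₂ : Finset (Fin d → ℤ) → (Fin d → ℤ) → (Fin d → ℤ) → ℤ :=
    fun T w v => (if v = w then N else 0) - if v ∈ T then c T v w else 0
  obtain ⟨κ, hκ, hgen⟩ := exists_generic Q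
    (Bs.biUnion (fun T => T.image (f₁ T)) ∪ Bs.biUnion (fun T => (Q \ T).image (f₂ T))) (by
      intro f hf
      simp only [Finset.mem_union, Finset.mem_biUnion, Finset.mem_image, Finset.mem_sdiff] at hf
      rcases hf with ⟨T, hT, u, hu, rfl⟩ | ⟨T, hT, w, ⟨hwQ, hwT⟩, rfl⟩
      · refine ⟨u, hsub T hT hu, ?_⟩
        simp only [f₁]
        rw [(hdual T hT).delta u hu u hu, if_pos rfl]
        exact (hdual T hT).pos.ne'
      · refine ⟨w, hwQ, ?_⟩
        simp only [f₂, if_pos, if_neg hwT, sub_zero]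
        exact (hdual T hT).pos.ne')
  let q : Fin d → ℤ := ∑ v ∈ Q, κ v • v
  have hgen₁ : ∀ T ∈ Bs, ∀ u ∈ T, c T u q ≠ 0 := by
    intro T hT u hu
    have := hgen (f₁ T u) (Finset.mem_union_left _ (Finset.mem_biUnion.2
      ⟨T, hT, Finset.mem_image_of_mem _ hu⟩))
    simp only [q, map_sum, map_nsmul]
    simpa only [f₁, nsmul_eq_mul] using this
  have hgen₂ : ∀ T ∈ Bs, ∀ w ∈ Q, w ∉ T → heightHom κ T (c T) w ≠ N * κ w := by
    intro T hT w hwQ hwT heq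
    apply hgen (f₂ T w) (Finset.mem_union_right _ (Finset.mem_biUnion.2
      ⟨T, hT, Finset.mem_image_of_mem _ (Finset.mem_sdiff.2 ⟨hwQ, hwT⟩)⟩))
    simp only [f₂, mul_sub, Finset.sum_sub_distrib, mul_ite, mul_zero, Finset.sum_ite_eq', hwQ,
      if_true]
    rw [Finset.sum_ite_mem, Finset.inter_eq_right.2 (hsub T hT), ← heightHom_apply, heq]
    ring
  refine ⟨N, κ, Bs.filter fun T => ∀ w ∈ Q, w ∉ T → heightHom κ T (c T) w < N * κ w, c, q,
    fun T hT => hdual T (Finset.mem_filter.1 hT).1, fun T hT => hsub T (Finset.mem_filter.1 hT).1,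
    hκ, rfl, fun T hT => hgen₁ T (Finset.mem_filter.1 hT).1,
    fun T hT => (Finset.mem_filter.1 hT).2, ?_⟩
  rintro x ⟨ρ, hρ, hx⟩
  have hLP := exists_basis_le hQ hspan (fun T hT h => (hmem T).2 ⟨hT, h⟩) hdual κ
  let K : ℤ := 1 + ∑ T ∈ Bs, ∑ u ∈ T, |c T u q|
  have hK : ∀ T ∈ Bs, ∀ u ∈ T, |c T u q| < K := by
    intro T hT u hu
    have h1 := Finset.single_le_sum (f := fun u => |c T u q|) (fun _ _ => abs_nonneg _) hu
    have h2 := Finset.single_le_sum (f := fun T => ∑ u ∈ T, |c T u q|)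
      (fun _ _ => Finset.sum_nonneg fun _ _ => abs_nonneg _) hT
    simp only [K]
    linarith
  let z := K • x + q
  have hK0 : 0 < K := by
    have : 0 ≤ ∑ T ∈ Bs, ∑ u ∈ T, |c T u q| :=
      Finset.sum_nonneg fun _ _ => Finset.sum_nonneg fun _ _ => abs_nonneg _
    simp only [K]; linarith
  have hzrep : toReal z = ∑ v ∈ Q, (K * ρ v + κ v) • toReal v := by
    have h1 : toReal z = (K : ℝ) • toReal x + ∑ v ∈ Q, (κ v : ℝ) • toReal v := by
      funext i
      simp [z, q, toReal]
    rw [h1, hx, Finset.smul_sum, ← Finset.sum_add_distrib]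
    exact Finset.sum_congr rfl fun v _ => by rw [add_smul, mul_smul]
  obtain ⟨T₀, hT₀, hz₀, -⟩ := hLP z _ (fun v => add_nonneg
    (mul_nonneg (by exact_mod_cast hK0.le) (hρ v)) (Nat.cast_nonneg _)) hzrep
  obtain ⟨T, hT, hmin⟩ := Finset.exists_min_image (Bs.filter fun T => ∀ v ∈ T, 0 ≤ c T v z)
    (fun T => heightHom κ T (c T) z) ⟨T₀, Finset.mem_filter.2 ⟨hT₀, hz₀⟩⟩
  rw [Finset.mem_filter] at hT
  obtain ⟨hT, hTz⟩ := hT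
  have hcz : ∀ v, c T v z = K * c T v x + c T v q := fun v => by
    simp only [z, map_add, map_zsmul, smul_eq_mul]
  have hpos : Pos T (c T) q x := by
    intro v hv
    have h1 := hTz v hv
    rw [hcz] at h1
    have h2 := abs_lt.1 (hK T hT v hv)
    have h3 := hgen₁ T hT v hv
    rcases lt_trichotomy (c T v x) 0 with h0 | h0 | h0
    · nlinarith
    · right
      refine ⟨h0, lt_of_le_of_ne ?_ h3.symm⟩
      simpa [h0] using h1
    · exact Or.inl h0
  have hzpos : ∀ v ∈ T, 1 ≤ c T v z := by
    intro v hv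
    have h2 := abs_lt.1 (hK T hT v hv)
    rw [hcz]
    rcases hpos v hv with h0 | ⟨h0, h1⟩
    · nlinarith
    · rw [h0]; linarith
  refine ⟨T, Finset.mem_filter.2 ⟨hT, fun w hwQ hwT => ?_⟩, hpos⟩
  refine lt_of_le_of_ne ?_ (hgen₂ T hT w hwQ hwT)
  by_contra! hlt
  have hN : (0 : ℝ) < N := by exact_mod_cast (hdual T hT).pos
  let s : ℝ := 1 + ∑ u ∈ T, |(c T u w : ℝ)|
  have hs : ∀ u ∈ T, |(c T u w : ℝ)| ≤ s := by
    intro u hu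
    have h1 := Finset.single_le_sum (f := fun u => |(c T u w : ℝ)|) (fun _ _ => abs_nonneg _) hu
    simp only [s]
    linarith
  have hs0 : 0 < s := by
    have : 0 ≤ ∑ u ∈ T, |(c T u w : ℝ)| := Finset.sum_nonneg fun _ _ => abs_nonneg _
    simp only [s]; linarith
  let ρ₁ : (Fin d → ℤ) → ℝ := fun v =>
    if v = w then s⁻¹ else if v ∈ T then (c T v z - s⁻¹ * c T v w) / N else 0
  have hρ₁ : ∀ v, 0 ≤ ρ₁ v := by
    intro v
    simp only [ρ₁]
    split_ifs with h1 h2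
    · positivity
    · refine div_nonneg ?_ hN.le
      have h3 : (1 : ℝ) ≤ c T v z := by exact_mod_cast hzpos v h2
      have h4 : s⁻¹ * c T v w ≤ 1 := by
        rw [inv_mul_le_iff₀ hs0, mul_one]
        exact (le_abs_self _).trans (hs v h2)
      linarith
    · exact le_rfl
  have hsumρ : ∀ {A : Type} [AddCommGroup A] [Module ℝ A] (g : (Fin d → ℤ) → A),
      ∑ v ∈ Q, ρ₁ v • g v =
        s⁻¹ • g w + ∑ v ∈ T, ((c T v z - s⁻¹ * c T v w) / N) • g v := by
    intro A _ _ g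
    have hTw : insert w T ⊆ Q := Finset.insert_subset hwQ (hsub T hT)
    rw [← Finset.sum_subset hTw, Finset.sum_insert hwT]
    · congr 1
      · simp [ρ₁]
      · refine Finset.sum_congr rfl fun v hv => ?_
        have : v ≠ w := fun h => hwT (h ▸ hv)
        simp [ρ₁, this, hv]
    · intro v _ hv
      rw [Finset.mem_insert, not_or] at hv
      simp [ρ₁, hv.1, hv.2]
  have hz₁ : toReal z = ∑ v ∈ Q, ρ₁ v • toReal v := by
    rw [hsumρ]
    have h1 := (hdual T hT).expand_real z
    have h2 := (hdual T hT).expand_real w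
    have h3 : ∑ v ∈ T, ((c T v z - s⁻¹ * c T v w) / N) • toReal v =
        (N : ℝ)⁻¹ • (∑ v ∈ T, (c T v z : ℝ) • toReal v -
          s⁻¹ • ∑ v ∈ T, (c T v w : ℝ) • toReal v) := by
      rw [Finset.smul_sum (r := s⁻¹), ← Finset.sum_sub_distrib, Finset.smul_sum]
      refine Finset.sum_congr rfl fun v _ => ?_
      rw [smul_smul, ← sub_smul, smul_smul]
      congr 1
      ring
    rw [h3, ← h1, ← h2, smul_sub, smul_comm s⁻¹, inv_smul_smul₀ hN.ne', inv_smul_smul₀ hN.ne']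
    abel
  obtain ⟨T', hT', hz', hle⟩ := hLP z ρ₁ hρ₁ hz₁
  have h1 := hmin T' (Finset.mem_filter.2 ⟨hT', hz'⟩)
  have h2 : (heightHom κ T (c T) z : ℝ) ≤ N * ∑ v ∈ Q, ρ₁ v * κ v := by
    refine le_trans ?_ hle
    exact_mod_cast h1
  have h3 := hsumρ (fun v => (κ v : ℝ))
  simp only [smul_eq_mul] at h3
  have h4 : (N : ℝ) * ∑ v ∈ T, ((c T v z - s⁻¹ * c T v w) / N) * κ v =
      heightHom κ T (c T) z - s⁻¹ * heightHom κ T (c T) w := by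
    rw [heightHom_apply, heightHom_apply]
    push_cast
    rw [Finset.mul_sum, Finset.mul_sum, ← Finset.sum_sub_distrib]
    refine Finset.sum_congr rfl fun v _ => ?_
    field_simp
  rw [h3, mul_add, h4] at h2
  have h5 : (N * κ w : ℝ) < heightHom κ T (c T) w := by exact_mod_cast hlt
  have h6 : s⁻¹ * (N * κ w) < s⁻¹ * heightHom κ T (c T) w :=
    mul_lt_mul_of_pos_left h5 (by positivity)
  linarith

/-- The integral points in the interior of the cone generated by `Q`. -/
def InInterior {d : ℕ} (Q : Finset (Fin d → ℤ)) (m : Fin d → ℤ) : Prop :=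
  ∃ ρ : (Fin d → ℤ) → ℝ, (∀ v, 0 < ρ v) ∧ toReal m = ∑ v ∈ Q, ρ v • toReal v

/-- The points of the half-open fundamental parallelepiped of `T` determined by `q`. -/
def IsBox {d : ℕ} (T : Finset (Fin d → ℤ)) (N : ℤ) (c : (Fin d → ℤ) → (Fin d → ℤ) →+ ℤ)
    (q b : Fin d → ℤ) : Prop :=
  ∀ v ∈ T, 0 ≤ c v b ∧ c v b ≤ N ∧ (c v b = 0 → 0 < c v q) ∧ (c v b = N → c v q < 0)

section Cone

variable {d : ℕ} {Q : Finset (Fin d → ℤ)} {h : (Fin d → ℤ) →+ ℤ}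

theorem toReal_add (x y : Fin d → ℤ) : toReal (x + y) = toReal x + toReal y := by
  funext i; simp [toReal]

theorem inCone_of_mem {v : Fin d → ℤ} (hv : v ∈ Q) : InCone Q v := by
  classical
  refine ⟨fun u => if u = v then 1 else 0, fun u => by dsimp only; split_ifs <;> norm_num, ?_⟩
  simp [hv]

theorem InCone.add {x y : Fin d → ℤ} (hx : InCone Q x) (hy : InCone Q y) : InCone Q (x + y) := by
  obtain ⟨ρ, h1, h2⟩ := hx
  obtain ⟨ρ', h1', h2'⟩ := hy
  refine ⟨ρ + ρ', fun v => add_nonneg (h1 v) (h1' v), ?_⟩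
  simp [toReal_add, h2, h2', add_smul, Finset.sum_add_distrib]

theorem inCone_zero : InCone Q 0 :=
  ⟨0, fun _ => le_rfl, by funext i; simp [toReal]⟩

theorem inCone_nsmul {x : Fin d → ℤ} (hx : InCone Q x) (k : ℕ) : InCone Q (k • x) := by
  induction k with
  | zero => simpa using inCone_zero
  | succ k ih => rw [succ_nsmul]; exact ih.add hx

theorem inCone_sum {ι : Type*} {s : Finset ι} {f : ι → Fin d → ℤ} (hf : ∀ i ∈ s, InCone Q (f i)) :
    InCone Q (∑ i ∈ s, f i) := by
  classical
  induction s using Finset.induction_on with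
  | empty => simpa using inCone_zero
  | insert a s ha ih =>
    rw [Finset.sum_insert ha]
    exact (hf a (Finset.mem_insert_self _ _)).add
      (ih fun i hi => hf i (Finset.mem_insert_of_mem hi))

theorem InInterior.add {x y : Fin d → ℤ} (hx : InInterior Q x) (hy : InCone Q y) :
    InInterior Q (x + y) := by
  obtain ⟨ρ, h1, h2⟩ := hx
  obtain ⟨ρ', h1', h2'⟩ := hy
  refine ⟨ρ + ρ', fun v => add_pos_of_pos_of_nonneg (h1 v) (h1' v), ?_⟩
  simp [toReal_add, h2, h2', add_smul, Finset.sum_add_distrib]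

theorem level_eq_sum (hQ : ∀ v ∈ Q, h v = 1) {m : Fin d → ℤ} {ρ : (Fin d → ℤ) → ℝ}
    (hm : toReal m = ∑ v ∈ Q, ρ v • toReal v) : (h m : ℝ) = ∑ v ∈ Q, ρ v := by
  obtain ⟨F, hF⟩ := exists_real_extension h
  rw [← hF, hm, map_sum]
  exact Finset.sum_congr rfl fun v hv => by rw [map_smul, hF, hQ v hv]; simp

theorem InCone.level_nonneg (hQ : ∀ v ∈ Q, h v = 1) {m : Fin d → ℤ} (hm : InCone Q m) :
    0 ≤ h m := by
  obtain ⟨ρ, h1, h2⟩ := hm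
  have := level_eq_sum hQ h2
  have h3 : (0 : ℝ) ≤ h m := by rw [this]; exact Finset.sum_nonneg fun v _ => h1 v
  exact_mod_cast h3

theorem finite_inCone_level (hQ : ∀ v ∈ Q, h v = 1) (k : ℤ) :
    {m | InCone Q m ∧ h m = k}.Finite := by
  let R : Fin d → ℤ := fun i => ∑ v ∈ Q, |v i|
  refine (Set.finite_Icc (-(k • R)) (k • R)).subset ?_
  rintro m ⟨⟨ρ, h1, h2⟩, h3⟩
  have hsum := level_eq_sum hQ h2
  have key : ∀ i, |m i| ≤ k * R i := by
    intro i
    have h4 : (m i : ℝ) = ∑ v ∈ Q, ρ v * (v i : ℝ) := by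
      have := congrFun h2 i
      simpa [toReal] using this
    have h5 : |(m i : ℝ)| ≤ k * (R i : ℝ) := by
      rw [h4, ← h3, hsum, Finset.sum_mul]
      refine (Finset.abs_sum_le_sum_abs _ _).trans (Finset.sum_le_sum fun v hv => ?_)
      rw [abs_mul, abs_of_nonneg (h1 v)]
      refine mul_le_mul_of_nonneg_left ?_ (h1 v)
      have : |v i| ≤ R i :=
        Finset.single_le_sum (f := fun v : Fin d → ℤ => |v i|) (fun _ _ => abs_nonneg _) hv
      exact_mod_cast this
    exact_mod_cast h5
  refine ⟨fun i => ?_, fun i => ?_⟩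
  · simpa using (abs_le.1 (key i)).1
  · simpa using (abs_le.1 (key i)).2

end Cone

section Basis

variable {d : ℕ} {Q T : Finset (Fin d → ℤ)} {N : ℤ} {c : (Fin d → ℤ) → (Fin d → ℤ) →+ ℤ}
  {q : Fin d → ℤ}

theorem IsDual.coord_sum (hT : IsDual T N c) (α : (Fin d → ℤ) → ℕ) {v : Fin d → ℤ} (hv : v ∈ T) :
    c v (∑ u ∈ T, α u • u) = N * α v := by
  rw [map_sum, Finset.sum_eq_single v]
  · rw [map_nsmul, hT.delta v hv v hv, if_pos rfl, nsmul_eq_mul, mul_comm]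
  · intro u hu huv
    rw [map_nsmul, hT.delta u hu v hv, if_neg huv, nsmul_zero]
  · exact fun h => absurd hv h

theorem IsDual.inCone (hT : IsDual T N c) (hTQ : T ⊆ Q) {x : Fin d → ℤ}
    (hx : ∀ v ∈ T, 0 ≤ c v x) : InCone Q x := by
  classical
  have hN : (0 : ℝ) < N := by exact_mod_cast hT.pos
  refine ⟨fun v => if v ∈ T then (c v x : ℝ) / N else 0, fun v => ?_, ?_⟩
  · dsimp only
    split_ifs with hv
    · exact div_nonneg (by exact_mod_cast hx v hv) hN.le
    · exact le_rfl
  · simp only [ite_smul, zero_smul]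
    rw [Finset.sum_ite_mem, Finset.inter_eq_right.2 hTQ, ← inv_smul_smul₀ hN.ne' (toReal x),
      hT.expand_real, Finset.smul_sum]
    exact Finset.sum_congr rfl fun v _ => by rw [smul_smul]; congr 1; ring

theorem IsDual.eq_of_subset (hT : IsDual T N c) {T' : Finset (Fin d → ℤ)} {c'}
    (hT' : IsDual T' N c') (h : T' ⊆ T) : T' = T :=
  Finset.eq_of_subset_of_card_le h (by rw [hT.card_eq, hT'.card_eq])

theorem Pos.nonneg {x : Fin d → ℤ} (hx : Pos T c q x) {v : Fin d → ℤ} (hv : v ∈ T) :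
    0 ≤ c v x := by
  rcases hx v hv with h | h
  · exact h.le
  · exact h.1.ge

theorem IsBox.pos {b : Fin d → ℤ} (hb : IsBox T N c q b) : Pos T c q b := fun v hv => by
  obtain ⟨h1, -, h2, -⟩ := hb v hv
  rcases h1.lt_or_eq with h | h
  · exact Or.inl h
  · exact Or.inr ⟨h.symm, h2 h.symm⟩

/-- Reflection of a box point. -/
theorem IsBox.pos_reflect (hT : IsDual T N c) {b : Fin d → ℤ} (hb : IsBox T N c q b) :
    Pos T c (-q) (∑ v ∈ T, v - b) := fun v hv => by
  obtain ⟨-, h1, -, h2⟩ := hb v hv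
  have h3 := hT.coord_sum (fun _ => 1) hv
  simp only [one_smul, Nat.cast_one, mul_one] at h3
  rw [map_sub, h3, map_neg]
  rcases h1.lt_or_eq with h | h
  · left; linarith
  · right; exact ⟨by linarith, by linarith [h2 h]⟩

theorem IsBox.unique (hT : IsDual T N c) {b b' : Fin d → ℤ} (hb : IsBox T N c q b)
    (hb' : IsBox T N c q b') {α α' : (Fin d → ℤ) → ℕ}
    (h : b + ∑ v ∈ T, α v • v = b' + ∑ v ∈ T, α' v • v) : b = b' ∧ ∀ v ∈ T, α v = α' v := by
  have hN := hT.pos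
  have key : ∀ v ∈ T, α v = α' v := by
    intro v hv
    have h1 := congrArg (c v) h
    rw [map_add, map_add, hT.coord_sum _ hv, hT.coord_sum _ hv] at h1
    obtain ⟨h2, h3, h4, h5⟩ := hb v hv
    obtain ⟨h2', h3', h4', h5'⟩ := hb' v hv
    rcases lt_trichotomy (α v) (α' v) with hlt | heq | hlt
    · have : (α v : ℤ) + 1 ≤ α' v := by exact_mod_cast hlt
      have h6 : N * ((α v : ℤ) + 1) ≤ N * α' v := mul_le_mul_of_nonneg_left this hN.le
      have h7 := h5 (by linarith)
      have h8 := h4' (by linarith)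
      linarith
    · exact heq
    · have : (α' v : ℤ) + 1 ≤ α v := by exact_mod_cast hlt
      have h6 : N * ((α' v : ℤ) + 1) ≤ N * α v := mul_le_mul_of_nonneg_left this hN.le
      have h7 := h5' (by linarith)
      have h8 := h4 (by linarith)
      linarith
  refine ⟨?_, key⟩
  rw [Finset.sum_congr rfl fun v hv => by rw [key v hv]] at h
  exact add_right_cancel h

theorem Pos.exists_box (hT : IsDual T N c) (hq : ∀ v ∈ T, c v q ≠ 0) {x : Fin d → ℤ}
    (hx : Pos T c q x) :
    ∃ (b : Fin d → ℤ) (α : (Fin d → ℤ) → ℕ), IsBox T N c q b ∧ x = b + ∑ v ∈ T, α v • v := by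
  have hN := hT.pos
  have key : ∀ v, ∃ a : ℕ, v ∈ T → 0 ≤ c v x - N * a ∧ c v x - N * a ≤ N ∧
      (c v x - N * a = 0 → 0 < c v q) ∧ (c v x - N * a = N → c v q < 0) := by
    intro v
    by_cases hv : v ∈ T
    swap
    · exact ⟨0, fun h => absurd h hv⟩
    have h0 := hx.nonneg hv
    rcases (hq v hv).lt_or_gt with hneg | hpos
    · have h1 : 0 < c v x := by
        rcases hx v hv with h | h
        · exact h
        · linarith [h.2]
      obtain ⟨a, ha⟩ := Int.eq_ofNat_of_zero_le
        (Int.ediv_nonneg (show 0 ≤ c v x - 1 by omega) hN.le)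
      refine ⟨a, fun _ => ?_⟩
      rw [← ha]
      have h2 := Int.emod_add_mul_ediv (c v x - 1) N
      have h3 := Int.emod_nonneg (c v x - 1) hN.ne'
      have h4 := Int.emod_lt_of_pos (c v x - 1) hN
      refine ⟨by linarith, by linarith, fun h => by linarith, fun _ => hneg⟩
    · obtain ⟨a, ha⟩ := Int.eq_ofNat_of_zero_le (Int.ediv_nonneg h0 hN.le)
      refine ⟨a, fun _ => ?_⟩
      rw [← ha]
      have h2 := Int.emod_add_mul_ediv (c v x) N
      have h3 := Int.emod_nonneg (c v x) hN.ne'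
      have h4 := Int.emod_lt_of_pos (c v x) hN
      refine ⟨by linarith, by linarith, fun _ => hpos, fun h => by linarith⟩
  choose α hα using key
  refine ⟨x - ∑ v ∈ T, α v • v, α, fun v hv => ?_, by abel⟩
  rw [map_sub, hT.coord_sum _ hv]
  exact hα v hv

end Basis

namespace IsTriangulation

variable {d : ℕ} {Q : Finset (Fin d → ℤ)} {N : ℤ} {κ : (Fin d → ℤ) → ℕ}
  {Δ : Finset (Finset (Fin d → ℤ))} {c : Finset (Fin d → ℤ) → (Fin d → ℤ) → (Fin d → ℤ) →+ ℤ}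
  {q : Fin d → ℤ} {h : (Fin d → ℤ) →+ ℤ}

theorem heightHom_le (ht : IsTriangulation Q N κ Δ c q) {T : Finset (Fin d → ℤ)} (hT : T ∈ Δ)
    {w : Fin d → ℤ} (hw : w ∈ Q) : heightHom κ T (c T) w ≤ N * κ w := by
  by_cases hwT : w ∈ T
  · exact (heightHom_mem (ht.dual T hT) hwT).le
  · exact (ht.lt_height T hT w hw hwT).le

/-- The piecewise linear function of the triangulation is the maximum of its linear pieces,
and ties are broken by the point `q'`. -/
theorem compare (ht : IsTriangulation Q N κ Δ c q) {T T' : Finset (Fin d → ℤ)} (hT : T ∈ Δ)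
    (hT' : T' ∈ Δ) {q' x : Fin d → ℤ} (hx : Pos T' (c T') q' x) :
    heightHom κ T (c T) x ≤ heightHom κ T' (c T') x ∧
      (heightHom κ T (c T) x = heightHom κ T' (c T') x →
        T' = T ∨ heightHom κ T (c T) q' < heightHom κ T' (c T') q') := by
  have hD := ht.dual T hT
  have hD' := ht.dual T' hT'
  have hN := hD.pos
  have hdiff : ∀ m, N * (heightHom κ T' (c T') m - heightHom κ T (c T) m) =
      ∑ v ∈ T', c T' v m * (N * κ v - heightHom κ T (c T) v) := by
    intro m
    rw [mul_sub, hD'.map_expand, hD'.map_expand, ← Finset.sum_sub_distrib]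
    exact Finset.sum_congr rfl fun v hv => by rw [heightHom_mem hD' hv]; ring
  have hnn : ∀ v ∈ T', 0 ≤ N * κ v - heightHom κ T (c T) v := fun v hv =>
    sub_nonneg.2 (ht.heightHom_le hT (ht.subset T' hT' hv))
  have hterm : ∀ v ∈ T', 0 ≤ c T' v x * (N * κ v - heightHom κ T (c T) v) := fun v hv =>
    mul_nonneg (hx.nonneg hv) (hnn v hv)
  refine ⟨?_, fun heq => ?_⟩
  · have h1 : 0 ≤ N * (heightHom κ T' (c T') x - heightHom κ T (c T) x) := by
      rw [hdiff]; exact Finset.sum_nonneg hterm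
    have := nonneg_of_mul_nonneg_right h1 hN
    linarith
  · have h1 := hdiff x
    rw [heq, sub_self, mul_zero] at h1
    have h2 := (Finset.sum_eq_zero_iff_of_nonneg hterm).1 h1.symm
    have h3 : ∀ v ∈ T', v ∉ T → 0 < c T' v q' * (N * κ v - heightHom κ T (c T) v) := by
      intro v hv hvT
      have h4 := ht.lt_height T hT v (ht.subset T' hT' hv) hvT
      have h5 : 0 < c T' v q' := by
        rcases hx v hv with h6 | h6
        · have := mul_pos h6 (sub_pos.2 h4)
          linarith [h2 v hv]
        · exact h6.2
      exact mul_pos h5 (sub_pos.2 h4)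
    have h4 : ∀ v ∈ T', v ∈ T → c T' v q' * (N * κ v - heightHom κ T (c T) v) = 0 := by
      intro v _ hvT
      rw [heightHom_mem hD hvT]; ring
    by_cases hsub : T' ⊆ T
    · exact Or.inl (hD.eq_of_subset hD' hsub)
    · right
      obtain ⟨v, hv, hvT⟩ := Finset.not_subset.1 hsub
      have h5 : 0 < N * (heightHom κ T' (c T') q' - heightHom κ T (c T) q') := by
        rw [hdiff]
        refine Finset.sum_pos' (fun u hu => ?_) ⟨v, hv, h3 v hv hvT⟩
        by_cases huT : u ∈ T
        · exact (h4 u hu huT).ge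
        · exact (h3 u hu huT).le
      have := pos_of_mul_pos_right h5 hN.le
      linarith

theorem pos_unique (ht : IsTriangulation Q N κ Δ c q) {T T' : Finset (Fin d → ℤ)} (hT : T ∈ Δ)
    (hT' : T' ∈ Δ) {q' x : Fin d → ℤ} (hx : Pos T (c T) q' x) (hx' : Pos T' (c T') q' x) :
    T = T' := by
  obtain ⟨h1, h2⟩ := ht.compare hT hT' hx'
  obtain ⟨h3, h4⟩ := ht.compare hT' hT hx
  have heq := le_antisymm h1 h3
  rcases h2 heq with h5 | h5
  · exact h5.symm
  · rcases h4 heq.symm with h6 | h6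
    · exact h6
    · linarith

theorem inInterior_of_pos_neg (ht : IsTriangulation Q N κ Δ c q) {T : Finset (Fin d → ℤ)}
    (hT : T ∈ Δ) {y : Fin d → ℤ} (hy : Pos T (c T) (-q) y) : InInterior Q y := by
  let K : ℤ := 1 + ∑ u ∈ T, |c T u q|
  have hK : ∀ u ∈ T, |c T u q| ≤ K := by
    intro u hu
    have h1 := Finset.single_le_sum (f := fun u => |c T u q|) (fun _ _ => abs_nonneg _) hu
    simp only [K]
    linarith
  have hK0 : 0 < K := by
    have : 0 ≤ ∑ u ∈ T, |c T u q| := Finset.sum_nonneg fun _ _ => abs_nonneg _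
    simp only [K]; linarith
  have hKR : (0 : ℝ) < K := by exact_mod_cast hK0
  obtain ⟨ρ, hρ, hz⟩ : InCone Q (K • y - q) := by
    refine (ht.dual T hT).inCone (ht.subset T hT) fun v hv => ?_
    rw [map_sub, map_zsmul, smul_eq_mul]
    have h1 := abs_le.1 (hK v hv)
    rcases hy v hv with h2 | ⟨h2, h3⟩
    · nlinarith
    · rw [map_neg] at h3
      rw [h2]; linarith
  refine ⟨fun v => (K : ℝ)⁻¹ * (ρ v + κ v), fun v => ?_, ?_⟩
  · have : (0 : ℝ) < κ v := by exact_mod_cast ht.κ_pos v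
    have := hρ v
    positivity
  · have h1 : toReal (K • y - q) = (K : ℝ) • toReal y - ∑ v ∈ Q, (κ v : ℝ) • toReal v := by
      funext i
      simp [ht.q_eq, toReal]
    rw [h1, sub_eq_iff_eq_add, ← Finset.sum_add_distrib] at hz
    rw [← inv_smul_smul₀ hKR.ne' (toReal y), hz, Finset.smul_sum]
    exact Finset.sum_congr rfl fun v _ => by rw [← add_smul, smul_smul]

theorem level_zero_box (ht : IsTriangulation Q N κ Δ c q) (hQ : ∀ v ∈ Q, h v = 1)
    {T : Finset (Fin d → ℤ)} (hT : T ∈ Δ) {b : Fin d → ℤ} (hb : IsBox T N (c T) q b)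
    (h0 : h b = 0) : b = 0 := by
  have hD := ht.dual T hT
  have h1 := hD.map_expand h b
  rw [h0, mul_zero, Finset.sum_congr rfl fun v hv => by
    rw [hQ v (ht.subset T hT hv), mul_one]] at h1
  have h2 := (Finset.sum_eq_zero_iff_of_nonneg fun v hv => hb.pos.nonneg hv).1 h1.symm
  exact hD.ext_of_coord fun v hv => by rw [h2 v hv, map_zero]

theorem level_reflect (ht : IsTriangulation Q N κ Δ c q) (hQ : ∀ v ∈ Q, h v = 1)
    {T : Finset (Fin d → ℤ)} (hT : T ∈ Δ) (b : Fin d → ℤ) :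
    h (∑ v ∈ T, v - b) = d - h b := by
  rw [map_sub, map_sum, Finset.sum_congr rfl fun v hv => hQ v (ht.subset T hT hv)]
  simp [(ht.dual T hT).card_eq]

theorem level_box_le (ht : IsTriangulation Q N κ Δ c q) (hQ : ∀ v ∈ Q, h v = 1) (hd : 0 < d)
    (hempty : ∀ y, InInterior Q y → h y ≠ d - 3)
    {T : Finset (Fin d → ℤ)} (hT : T ∈ Δ) {b : Fin d → ℤ} (hb : IsBox T N (c T) q b) :
    h b ≤ 2 := by
  by_contra! hlt
  obtain ⟨v, hv⟩ : T.Nonempty := by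
    rw [← Finset.card_pos, (ht.dual T hT).card_eq]; exact hd
  have hvQ := ht.subset T hT hv
  obtain ⟨j, hj⟩ := Int.eq_ofNat_of_zero_le (show 0 ≤ h b - 3 by linarith)
  refine hempty _ ((ht.inInterior_of_pos_neg hT (hb.pos_reflect (ht.dual T hT))).add
    (inCone_nsmul (inCone_of_mem hvQ) j)) ?_
  rw [map_add, ht.level_reflect hQ hT, map_nsmul, hQ v hvQ]
  simp
  linarith

end IsTriangulation

theorem prod_single_one {A M ι : Type*} [CommSemiring A] [AddCommMonoid M] (s : Finset ι)
    (f : ι → M) : ∏ i ∈ s, AddMonoidAlgebra.single (f i) (1 : A) =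
      AddMonoidAlgebra.single (∑ i ∈ s, f i) 1 := by
  classical
  induction s using Finset.induction_on with
  | empty => simp [AddMonoidAlgebra.one_def]
  | insert a s ha ih =>
    rw [Finset.prod_insert ha, Finset.sum_insert ha, ih, AddMonoidAlgebra.single_mul_single,
      mul_one]

theorem aeval_single_one {A M ι : Type*} [CommRing A] [AddCommMonoid M] [Fintype ι]
    (f : ι → M) (P : MvPolynomial ι A) :
    MvPolynomial.aeval (fun i => AddMonoidAlgebra.single (f i) (1 : A)) P =
      ∑ α ∈ P.support, AddMonoidAlgebra.single (∑ i, α i • f i) (P.coeff α) := by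
  rw [MvPolynomial.aeval_def, MvPolynomial.eval₂_eq']
  refine Finset.sum_congr rfl fun α _ => ?_
  simp only [AddMonoidAlgebra.single_pow, one_pow]
  rw [prod_single_one, ← Algebra.smul_def, AddMonoidAlgebra.smul_single, smul_eq_mul, mul_one]

theorem eq_zero_of_box_relation {d : ℕ} {T : Finset (Fin d → ℤ)} {N : ℤ}
    {c : (Fin d → ℤ) → (Fin d → ℤ) →+ ℤ} {q : Fin d → ℤ} {F : Type*} [Field F]
    (hT : IsDual T N c) (hNF : (N : F) ≠ 0) (B : Finset (Fin d → ℤ))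
    (hB : ∀ b ∈ B, IsBox T N c q b) (s : (Fin d → ℤ) → MvPolynomial (Fin d) F)
    (h : ∑ b ∈ B, AddMonoidAlgebra.single b (1 : F) *
      MvPolynomial.aeval (fun j => ∑ v ∈ T, AddMonoidAlgebra.single v (v j : F)) (s b) = 0) :
    ∀ b ∈ B, s b = 0 := by
  classical
  let L : Fin d → MvPolynomial T F := fun j => ∑ v : T, ((v : Fin d → ℤ) j : F) • MvPolynomial.X v
  let p : (Fin d → ℤ) → MvPolynomial T F := fun b => MvPolynomial.aeval L (s b)
  have hfac : ∀ b, MvPolynomial.aeval (fun j => ∑ v ∈ T, AddMonoidAlgebra.single v (v j : F)) (s b)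
      = ∑ α ∈ (p b).support,
        AddMonoidAlgebra.single (∑ v : T, α v • (v : Fin d → ℤ)) ((p b).coeff α) := by
    intro b
    rw [← aeval_single_one, MvPolynomial.comp_aeval_apply]
    congr 2
    funext j
    simp only [L, map_sum, map_smul, MvPolynomial.aeval_X, AddMonoidAlgebra.smul_single,
      smul_eq_mul, mul_one]
    exact (Finset.sum_coe_sort T fun v => AddMonoidAlgebra.single v (v j : F)).symm
  have hp : ∀ b ∈ B, p b = 0 := by
    intro b₀ hb₀
    ext α₀
    rw [MvPolynomial.coeff_zero]
    have h1 := congrArg (fun x => x.coeff (b₀ + ∑ v : T, α₀ v • (v : Fin d → ℤ))) h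
    simp only [hfac, Finset.mul_sum, AddMonoidAlgebra.single_mul_single, one_mul,
      AddMonoidAlgebra.coeff_sum, Finsupp.finsetSum_apply, AddMonoidAlgebra.coeff_single,
      AddMonoidAlgebra.coeff_zero, Finsupp.coe_zero, Pi.zero_apply, Finsupp.single_apply] at h1
    have hinj : ∀ b ∈ B, ∀ α : T →₀ ℕ,
        b + ∑ v : T, α v • (v : Fin d → ℤ) = b₀ + ∑ v : T, α₀ v • (v : Fin d → ℤ) →
          b = b₀ ∧ α = α₀ := by
      intro b hb α heq
      have hext : ∀ α : T →₀ ℕ, ∑ v : T, α v • (v : Fin d → ℤ) =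
          ∑ v ∈ T, (if hv : v ∈ T then α ⟨v, hv⟩ else 0) • v := by
        intro α
        rw [← Finset.sum_coe_sort T]
        exact Finset.sum_congr rfl fun v _ => by simp
      rw [hext, hext] at heq
      obtain ⟨h2, h3⟩ := IsBox.unique hT (hB b hb) (hB b₀ hb₀) heq
      refine ⟨h2, Finsupp.ext fun v => ?_⟩
      simpa using h3 v v.2
    rw [Finset.sum_eq_single b₀, Finset.sum_eq_single α₀, if_pos rfl] at h1
    · exact h1
    · intro α _ hα
      exact if_neg fun heq => hα (hinj b₀ hb₀ α heq).2
    · intro hα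
      rw [if_pos rfl]
      exact MvPolynomial.notMem_support_iff.1 hα
    · intro b hb hne
      exact Finset.sum_eq_zero fun α _ => if_neg fun heq => hne (hinj b hb α heq).1
    · exact fun hb => absurd hb₀ hb
  intro b hb
  let ψ : MvPolynomial T F →ₐ[F] MvPolynomial (Fin d) F := MvPolynomial.aeval fun v : T =>
    ∑ j, (c v (Pi.single j 1) : F) • (MvPolynomial.X j : MvPolynomial (Fin d) F)
  have h2 : ∀ i, ψ (L i) = (N : F) • MvPolynomial.X i := by
    intro i
    simp only [L, ψ, map_sum, map_smul, MvPolynomial.aeval_X, Finset.smul_sum, smul_smul]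
    rw [Finset.sum_comm]
    simp only [← Finset.sum_smul]
    have h3 : ∀ j, ∑ v : T, ((v : Fin d → ℤ) i : F) * (c v (Pi.single j 1) : F) =
        if j = i then (N : F) else 0 := by
      intro j
      have h4 := congrArg (Int.cast : ℤ → F) (congrFun (hT.expand (Pi.single j 1)) i)
      rw [Finset.sum_coe_sort T fun v => (v i : F) * (c v (Pi.single j 1) : F)]
      simp only [Finset.sum_apply, Pi.smul_apply, smul_eq_mul, Int.cast_mul, Int.cast_sum,
        Pi.single_apply] at h4
      rw [Finset.sum_congr rfl fun v _ => mul_comm (v i : F) _, ← h4]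
      by_cases hij : j = i
      · simp [hij]
      · simp [hij, Ne.symm hij]
    simp only [h3, ite_smul, zero_smul, Finset.sum_ite_eq', Finset.mem_univ, if_true]
  have h1 := MvPolynomial.comp_aeval_apply L ψ (s b)
  rw [show MvPolynomial.aeval L (s b) = 0 from hp b hb, map_zero, funext h2] at h1
  have h5 := congrArg (MvPolynomial.aeval (R := F) fun i => (N : F)⁻¹ •
    (MvPolynomial.X i : MvPolynomial (Fin d) F)) h1.symm
  rw [map_zero, MvPolynomial.comp_aeval_apply] at h5
  simpa [smul_smul, hNF, MvPolynomial.aeval_X_left] using h5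

/-- Coordinate `j` of the linear system of parameters `∑ e(v) v X^v`. -/
def paramForm {d : ℕ} (A : Type*) [CommRing A] (Q : Finset (Fin d → ℤ)) (e : (Fin d → ℤ) → A)
    (j : Fin d) : AddMonoidAlgebra A (Fin d → ℤ) :=
  ∑ v ∈ Q, AddMonoidAlgebra.single v ((v j : A) * e v)

/-- The combination of the monomials `X^b` with coefficients `u_b t_b(θ)`. -/
def paramSum {d : ℕ} (A : Type*) [CommRing A] (Q B : Finset (Fin d → ℤ)) (e u : (Fin d → ℤ) → A)
    (t : (Fin d → ℤ) → MvPolynomial (Fin d) ℤ) : AddMonoidAlgebra A (Fin d → ℤ) :=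
  ∑ b ∈ B, AddMonoidAlgebra.single b (u b) *
    MvPolynomial.eval₂Hom (Int.castRingHom _) (paramForm A Q e) (t b)

theorem map_paramSum {d : ℕ} {A A' : Type*} [CommRing A] [CommRing A']
    {Q B : Finset (Fin d → ℤ)} {e u : (Fin d → ℤ) → A} {e' u' : (Fin d → ℤ) → A'}
    {t : (Fin d → ℤ) → MvPolynomial (Fin d) ℤ}
    (φ : AddMonoidAlgebra A (Fin d → ℤ) →+* AddMonoidAlgebra A' (Fin d → ℤ))
    (he : ∀ v ∈ Q, ∀ z : ℤ, φ (AddMonoidAlgebra.single v (z * e v)) =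
      AddMonoidAlgebra.single v (z * e' v))
    (hu : ∀ b ∈ B, φ (AddMonoidAlgebra.single b (u b)) = AddMonoidAlgebra.single b (u' b)) :
    φ (paramSum A Q B e u t) = paramSum A' Q B e' u' t := by
  simp only [paramSum, map_sum, map_mul]
  refine Finset.sum_congr rfl fun b hb => ?_
  rw [hu b hb]
  congr 1
  rw [MvPolynomial.map_eval₂Hom, Subsingleton.elim (φ.comp _) (Int.castRingHom _)]
  congr 2
  funext j
  simp only [paramForm, map_sum]
  exact Finset.sum_congr rfl fun v hv => he v hv _

/-- Rescaling by a character and reducing modulo `ℓ`. -/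
theorem paramSum_degenerate {d : ℕ} (ℓ : ℕ) [Fact ℓ.Prime] {Q B : Finset (Fin d → ℤ)}
    (γ : (Fin d → ℤ) →+ ℤ) {ω W : (Fin d → ℤ) → ℤ} (hω : ∀ v ∈ Q, γ v ≤ ω v)
    (hW : ∀ b ∈ B, γ b ≤ W b) {t : (Fin d → ℤ) → MvPolynomial (Fin d) ℤ}
    (h : paramSum ℚ Q B (fun v => (ℓ : ℚ) ^ ω v) (fun b => (ℓ : ℚ) ^ W b) t = 0) :
    paramSum (ZMod ℓ) Q B (fun v => if γ v = ω v then 1 else 0)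
      (fun b => if γ b = W b then 1 else 0) t = 0 := by
  have hℓ : (ℓ : ℚ) ≠ 0 := by exact_mod_cast (Fact.out : ℓ.Prime).ne_zero
  let χ : AddMonoidAlgebra ℚ (Fin d → ℤ) →ₐ[ℚ] AddMonoidAlgebra ℚ (Fin d → ℤ) :=
    AddMonoidAlgebra.lift ℚ _ _
      { toFun := fun m => AddMonoidAlgebra.single m.toAdd ((ℓ : ℚ) ^ (-γ m.toAdd))
        map_one' := by simp [AddMonoidAlgebra.one_def]
        map_mul' := fun a b => by
          rw [AddMonoidAlgebra.single_mul_single, ← zpow_add₀ hℓ, toAdd_mul, map_add, neg_add] }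
  have hχ : ∀ m a, χ (AddMonoidAlgebra.single m a) =
      AddMonoidAlgebra.single m (a * (ℓ : ℚ) ^ (-γ m)) := by
    intro m a
    simp [χ, AddMonoidAlgebra.lift_single, AddMonoidAlgebra.smul_single]
  have h1 := map_paramSum (Q := Q) (B := B) (t := t)
    (e := fun v => (ℓ : ℚ) ^ ω v) (u := fun b => (ℓ : ℚ) ^ W b)
    (e' := fun v => (ℓ : ℚ) ^ (ω v - γ v)) (u' := fun b => (ℓ : ℚ) ^ (W b - γ b))
    (χ : AddMonoidAlgebra ℚ (Fin d → ℤ) →+* AddMonoidAlgebra ℚ (Fin d → ℤ))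
    (fun v _ z => by
      rw [RingHom.coe_coe, hχ, mul_assoc, ← zpow_add₀ hℓ, sub_eq_add_neg])
    (fun b _ => by rw [RingHom.coe_coe, hχ, ← zpow_add₀ hℓ, sub_eq_add_neg])
  rw [h, map_zero] at h1
  let f := AddMonoidAlgebra.mapRingHom (Fin d → ℤ) (Int.castRingHom ℚ)
  have h2 := map_paramSum (Q := Q) (B := B) (t := t)
    (e := fun v => (ℓ : ℤ) ^ (ω v - γ v).toNat) (u := fun b => (ℓ : ℤ) ^ (W b - γ b).toNat)
    (e' := fun v => (ℓ : ℚ) ^ (ω v - γ v)) (u' := fun b => (ℓ : ℚ) ^ (W b - γ b)) f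
    (fun v hv z => by
      simp only [f, AddMonoidAlgebra.mapRingHom_single]
      congr 1
      simp only [Int.cast_id, eq_intCast, Int.cast_mul, Int.cast_pow, Int.cast_natCast]
      rw [← zpow_natCast, Int.toNat_of_nonneg (sub_nonneg.2 (hω v hv))])
    (fun b hb => by
      simp only [f, AddMonoidAlgebra.mapRingHom_single]
      congr 1
      simp only [eq_intCast, Int.cast_pow, Int.cast_natCast]
      rw [← zpow_natCast, Int.toNat_of_nonneg (sub_nonneg.2 (hW b hb))])
  have h3 := AddMonoidAlgebra.map_injective (M := Fin d → ℤ) (Int.castAddHom ℚ) Int.cast_injective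
    (a₁ := paramSum ℤ Q B (fun v => (ℓ : ℤ) ^ (ω v - γ v).toNat)
      (fun b => (ℓ : ℤ) ^ (W b - γ b).toNat) t) (a₂ := 0)
    ((h2.trans h1.symm).trans (map_zero f).symm)
  have hpow : ∀ {a b : ℤ}, a ≤ b → ((ℓ : ZMod ℓ) ^ (b - a).toNat) = if a = b then 1 else 0 := by
    intro a b hab
    rw [ZMod.natCast_self]
    split_ifs with h
    · simp [h]
    · exact zero_pow (by omega)
  have h4 := map_paramSum (Q := Q) (B := B) (t := t)
    (e := fun v => (ℓ : ℤ) ^ (ω v - γ v).toNat) (u := fun b => (ℓ : ℤ) ^ (W b - γ b).toNat)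
    (e' := fun v => if γ v = ω v then (1 : ZMod ℓ) else 0)
    (u' := fun b => if γ b = W b then 1 else 0)
    (AddMonoidAlgebra.mapRingHom (Fin d → ℤ) (Int.castRingHom (ZMod ℓ)))
    (fun v hv z => by
      simp only [AddMonoidAlgebra.mapRingHom_single]
      congr 1
      simp only [Int.cast_id, eq_intCast, Int.cast_mul, Int.cast_pow, Int.cast_natCast]
      rw [hpow (hω v hv)])
    (fun b hb => by
      simp only [AddMonoidAlgebra.mapRingHom_single]
      congr 1
      simp only [eq_intCast, Int.cast_pow, Int.cast_natCast]
      rw [hpow (hW b hb)])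
  rw [← h4, h3, map_zero]

theorem exists_integer_multiple {σ : Type*} (p : MvPolynomial σ ℚ) :
    ∃ D : ℤ, D ≠ 0 ∧ ∃ t : MvPolynomial σ ℤ,
      MvPolynomial.map (Int.castRingHom ℚ) t = MvPolynomial.C (D : ℚ) * p := by
  induction p using MvPolynomial.induction_on with
  | C a =>
    refine ⟨a.den, by exact_mod_cast a.den_nz, MvPolynomial.C a.num, ?_⟩
    rw [MvPolynomial.map_C, ← MvPolynomial.C_mul]
    congr 1
    rw [Int.cast_natCast, mul_comm, Rat.mul_den_eq_num]
    rfl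
  | add p₁ p₂ h₁ h₂ =>
    obtain ⟨D₁, h1, t₁, h2⟩ := h₁
    obtain ⟨D₂, h3, t₂, h4⟩ := h₂
    refine ⟨D₁ * D₂, mul_ne_zero h1 h3, MvPolynomial.C D₂ * t₁ + MvPolynomial.C D₁ * t₂, ?_⟩
    rw [map_add, map_mul, map_mul, h2, h4, MvPolynomial.map_C, MvPolynomial.map_C, eq_intCast,
      eq_intCast, Int.cast_mul, MvPolynomial.C_mul]
    ring
  | mul_X p i h =>
    obtain ⟨D, h1, t, h2⟩ := h
    exact ⟨D, h1, t * MvPolynomial.X i, by rw [map_mul, h2, MvPolynomial.map_X, mul_assoc]⟩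

theorem exists_common_integer_multiple {σ ι : Type*} (B : Finset ι) (p : ι → MvPolynomial σ ℚ) :
    ∃ D : ℤ, D ≠ 0 ∧ ∃ t : ι → MvPolynomial σ ℤ,
      ∀ b ∈ B, MvPolynomial.map (Int.castRingHom ℚ) (t b) = MvPolynomial.C (D : ℚ) * p b := by
  classical
  choose D hD t ht using fun b => exists_integer_multiple (p b)
  refine ⟨∏ b ∈ B, D b, Finset.prod_ne_zero_iff.2 fun b _ => hD b,
    fun b => MvPolynomial.C (∏ b' ∈ B.erase b, D b') * t b, fun b hb => ?_⟩
  rw [map_mul, ht, MvPolynomial.map_C, ← mul_assoc, ← MvPolynomial.C_mul,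
    ← Finset.prod_erase_mul _ _ hb]
  simp

theorem eval₂Hom_intCast {σ A R : Type*} [CommRing A] [CommRing R] [Algebra A R] (θ : σ → R)
    (t : MvPolynomial σ ℤ) : MvPolynomial.eval₂Hom (Int.castRingHom R) θ t =
      MvPolynomial.aeval θ (MvPolynomial.map (Int.castRingHom A) t) := by
  rw [MvPolynomial.aeval_def, MvPolynomial.eval₂_map, MvPolynomial.coe_eval₂Hom]
  congr 1
  exact Subsingleton.elim _ _

namespace IsTriangulation

variable {d : ℕ} {Q : Finset (Fin d → ℤ)} {N : ℤ} {κ : (Fin d → ℤ) → ℕ}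
  {Δ : Finset (Finset (Fin d → ℤ))} {c : Finset (Fin d → ℤ) → (Fin d → ℤ) → (Fin d → ℤ) →+ ℤ}
  {q : Fin d → ℤ} {B : Finset (Fin d → ℤ)} {τ : (Fin d → ℤ) → Finset (Fin d → ℤ)} {ℓ : ℕ}

theorem map_eq_zero_of_paramSum (ht : IsTriangulation Q N κ Δ c q)
    (hτ : ∀ b ∈ B, τ b ∈ Δ ∧ IsBox (τ b) N (c (τ b)) q b) [Fact ℓ.Prime] (hℓ : ¬ (ℓ : ℤ) ∣ N)
    {t : (Fin d → ℤ) → MvPolynomial (Fin d) ℤ}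
    (h : paramSum ℚ Q B (fun v => (ℓ : ℚ) ^ (N * κ v))
      (fun b => (ℓ : ℚ) ^ (heightHom κ (τ b) (c (τ b)) b)) t = 0) :
    ∀ b ∈ B, MvPolynomial.map (Int.castRingHom (ZMod ℓ)) (t b) = 0 := by
  classical
  by_contra! hex
  obtain ⟨b₀, hb₀, hmax⟩ := Finset.exists_max_image
    (B.filter fun b => MvPolynomial.map (Int.castRingHom (ZMod ℓ)) (t b) ≠ 0)
    (fun b => heightHom κ (τ b) (c (τ b)) q) (by
      obtain ⟨b, hb, hne⟩ := hex
      exact ⟨b, Finset.mem_filter.2 ⟨hb, hne⟩⟩)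
  rw [Finset.mem_filter] at hb₀
  set T := τ b₀ with hTdef
  obtain ⟨hT, -⟩ := hτ b₀ hb₀.1
  have hD := ht.dual T hT
  have hcmp := fun b (hb : b ∈ B) => ht.compare hT (hτ b hb).1 (hτ b hb).2.pos
  have h1 := paramSum_degenerate ℓ (heightHom κ T (c T)) (fun v hv => ht.heightHom_le hT hv)
    (fun b hb => (hcmp b hb).1) h
  have hform : paramForm (ZMod ℓ) Q (fun v => if heightHom κ T (c T) v = N * κ v then 1 else 0) =
      fun j => ∑ v ∈ T, AddMonoidAlgebra.single v (v j : ZMod ℓ) := by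
    funext j
    simp only [paramForm]
    rw [← Finset.sum_subset (ht.subset T hT)]
    · refine Finset.sum_congr rfl fun v hv => ?_
      rw [if_pos (heightHom_mem hD hv), mul_one]
    · intro v hvQ hvT
      rw [if_neg (ht.lt_height T hT v hvQ hvT).ne, mul_zero, AddMonoidAlgebra.single_zero]
  refine hb₀.2 (eq_zero_of_box_relation (F := ZMod ℓ) (q := q) hD
    (by rwa [Ne, ZMod.intCast_zmod_eq_zero_iff_dvd]) (B.filter fun b => τ b = T)
    (fun b hb => ?_) (fun b => MvPolynomial.map (Int.castRingHom (ZMod ℓ)) (t b)) ?_ b₀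
    (Finset.mem_filter.2 ⟨hb₀.1, rfl⟩))
  · rw [Finset.mem_filter] at hb
    rw [← hb.2]
    exact (hτ b hb.1).2
  · rw [← h1, paramSum, hform, ← Finset.sum_subset (Finset.filter_subset (fun b => τ b = T) B)]
    · refine Finset.sum_congr rfl fun b hb => ?_
      rw [Finset.mem_filter] at hb
      rw [hb.2, if_pos rfl, eval₂Hom_intCast (A := ZMod ℓ)]
    · intro b hb hbT
      have hbT : τ b ≠ T := fun h => hbT (Finset.mem_filter.2 ⟨hb, h⟩)
      by_cases heq : heightHom κ T (c T) b = heightHom κ (τ b) (c (τ b)) b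
      · have hlt := ((hcmp b hb).2 heq).resolve_left hbT
        have h0 : MvPolynomial.map (Int.castRingHom (ZMod ℓ)) (t b) = 0 := by
          by_contra hne
          exact absurd (hmax b (Finset.mem_filter.2 ⟨hb, hne⟩)) (not_le.2 hlt)
        rw [eval₂Hom_intCast (A := ZMod ℓ), h0, map_zero, mul_zero]
      · rw [if_neg heq, AddMonoidAlgebra.single_zero, zero_mul]

theorem eq_zero_of_paramSum (ht : IsTriangulation Q N κ Δ c q)
    (hτ : ∀ b ∈ B, τ b ∈ Δ ∧ IsBox (τ b) N (c (τ b)) q b) (hp : ℓ.Prime) (hℓ : ¬ (ℓ : ℤ) ∣ N)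
    {t : (Fin d → ℤ) → MvPolynomial (Fin d) ℤ}
    (h : paramSum ℚ Q B (fun v => (ℓ : ℚ) ^ (N * κ v))
      (fun b => (ℓ : ℚ) ^ (heightHom κ (τ b) (c (τ b)) b)) t = 0) :
    ∀ b ∈ B, t b = 0 := by
  classical
  have := Fact.mk hp
  have key : ∀ k : ℕ, ∀ t : (Fin d → ℤ) → MvPolynomial (Fin d) ℤ,
      paramSum ℚ Q B (fun v => (ℓ : ℚ) ^ (N * κ v))
        (fun b => (ℓ : ℚ) ^ (heightHom κ (τ b) (c (τ b)) b)) t = 0 →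
      ∀ b ∈ B, MvPolynomial.C ((ℓ : ℤ) ^ k) ∣ t b := by
    intro k
    induction k with
    | zero => intro t _ b _; simp
    | succ k ih =>
      intro t h
      have h1 : ∀ b, ∃ t', b ∈ B → t b = MvPolynomial.C (ℓ : ℤ) * t' := by
        intro b
        by_cases hb : b ∈ B
        · have h2 := ht.map_eq_zero_of_paramSum hτ hℓ h b hb
          have h3 : MvPolynomial.C (ℓ : ℤ) ∣ t b := by
            rw [MvPolynomial.C_dvd_iff_dvd_coeff]
            intro i
            have := congrArg (MvPolynomial.coeff i) h2
            rw [MvPolynomial.coeff_map, MvPolynomial.coeff_zero] at this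
            exact (ZMod.intCast_zmod_eq_zero_iff_dvd _ _).1 this
          obtain ⟨t', ht'⟩ := h3
          exact ⟨t', fun _ => ht'⟩
        · exact ⟨0, fun h => absurd h hb⟩
      choose t' ht' using h1
      have h4 : paramSum ℚ Q B (fun v => (ℓ : ℚ) ^ (N * κ v))
          (fun b => (ℓ : ℚ) ^ (heightHom κ (τ b) (c (τ b)) b)) t' = 0 := by
        have h5 : paramSum ℚ Q B (fun v => (ℓ : ℚ) ^ (N * κ v))
            (fun b => (ℓ : ℚ) ^ (heightHom κ (τ b) (c (τ b)) b)) t = (ℓ : ℚ) •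
          paramSum ℚ Q B (fun v => (ℓ : ℚ) ^ (N * κ v))
            (fun b => (ℓ : ℚ) ^ (heightHom κ (τ b) (c (τ b)) b)) t' := by
          rw [paramSum, paramSum, Finset.smul_sum]
          refine Finset.sum_congr rfl fun b hb => ?_
          rw [ht' b hb, map_mul, MvPolynomial.eval₂Hom_C, mul_left_comm]
          simp [Algebra.smul_def]
        rw [h5] at h
        exact (smul_eq_zero.1 h).resolve_left (by exact_mod_cast hp.ne_zero)
      intro b hb
      rw [ht' b hb, pow_succ', MvPolynomial.C_mul]
      exact mul_dvd_mul_left _ (ih t' h4 b hb)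
  intro b hb
  ext i
  rw [MvPolynomial.coeff_zero]
  have h1 := (MvPolynomial.C_dvd_iff_dvd_coeff _ _).1
    (key ((t b).coeff i).natAbs t h b hb) i
  refine Int.eq_zero_of_abs_lt_dvd h1 ?_
  have h2 := Nat.lt_pow_self (n := ((t b).coeff i).natAbs) hp.one_lt
  rw [Int.abs_eq_natAbs]
  exact_mod_cast h2

/-- The monomials of the box points are independent over the linear system of parameters. -/
theorem eq_zero_of_aeval (ht : IsTriangulation Q N κ Δ c q)
    (hτ : ∀ b ∈ B, τ b ∈ Δ ∧ IsBox (τ b) N (c (τ b)) q b) (hp : ℓ.Prime) (hℓ : ¬ (ℓ : ℤ) ∣ N)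
    {s : (Fin d → ℤ) → MvPolynomial (Fin d) ℚ}
    (h : ∑ b ∈ B, MvPolynomial.aeval (paramForm ℚ Q fun v => (ℓ : ℚ) ^ (N * κ v)) (s b) *
      AddMonoidAlgebra.single b (1 : ℚ) = 0) : ∀ b ∈ B, s b = 0 := by
  have hℓ0 : (ℓ : ℚ) ≠ 0 := by exact_mod_cast hp.ne_zero
  let W : (Fin d → ℤ) → ℤ := fun b => heightHom κ (τ b) (c (τ b)) b
  obtain ⟨D, hD, t, hst⟩ := exists_common_integer_multiple B
    fun b => MvPolynomial.C ((ℓ : ℚ) ^ (-W b)) * s b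
  have hrel : paramSum ℚ Q B (fun v => (ℓ : ℚ) ^ (N * κ v)) (fun b => (ℓ : ℚ) ^ W b) t = 0 := by
    rw [← smul_zero (D : ℚ), ← h, paramSum, Finset.smul_sum]
    refine Finset.sum_congr rfl fun b hb => ?_
    rw [eval₂Hom_intCast (A := ℚ), hst b hb, ← mul_assoc, ← MvPolynomial.C_mul, map_mul,
      MvPolynomial.algHom_C, ← Algebra.smul_def, mul_smul_comm, mul_smul]
    congr 1
    rw [← smul_mul_assoc, AddMonoidAlgebra.smul_single, smul_eq_mul, ← zpow_add₀ hℓ0,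
      neg_add_cancel, zpow_zero, mul_comm]
  intro b hb
  have h1 := hst b hb
  rw [ht.eq_zero_of_paramSum hτ hp hℓ hrel b hb, map_zero] at h1
  have h2 : MvPolynomial.C (D : ℚ) ≠ (0 : MvPolynomial (Fin d) ℚ) := by
    rw [Ne, MvPolynomial.C_eq_zero]; exact_mod_cast hD
  have h3 : MvPolynomial.C ((ℓ : ℚ) ^ (-W b)) ≠ (0 : MvPolynomial (Fin d) ℚ) := by
    rw [Ne, MvPolynomial.C_eq_zero]; exact zpow_ne_zero _ hℓ0
  exact ((mul_eq_zero.1 ((mul_eq_zero.1 h1.symm).resolve_left h2)).resolve_left h3)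

end IsTriangulation

/-- The degree `k` part of the semigroup algebra of the cone generated by `Q`. -/
def gradedPiece {d : ℕ} (Q : Finset (Fin d → ℤ)) (h : (Fin d → ℤ) →+ ℤ) (k : ℤ) :
    Submodule ℚ (AddMonoidAlgebra ℚ (Fin d → ℤ)) :=
  Submodule.span ℚ ((fun m => AddMonoidAlgebra.single m 1) '' {m | InCone Q m ∧ h m = k})

section gradedPiece

variable {d : ℕ} {Q : Finset (Fin d → ℤ)} {h : (Fin d → ℤ) →+ ℤ}

theorem single_mem_gradedPiece {m : Fin d → ℤ} (hm : InCone Q m) (a : ℚ) :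
    AddMonoidAlgebra.single m a ∈ gradedPiece Q h (h m) := by
  have h1 : AddMonoidAlgebra.single m a = a • AddMonoidAlgebra.single m (1 : ℚ) := by
    rw [AddMonoidAlgebra.smul_single, smul_eq_mul, mul_one]
  rw [h1]
  exact Submodule.smul_mem _ _ (Submodule.subset_span ⟨m, ⟨hm, rfl⟩, rfl⟩)

theorem mul_mem_gradedPiece {k l : ℤ} {x y : AddMonoidAlgebra ℚ (Fin d → ℤ)}
    (hx : x ∈ gradedPiece Q h k) (hy : y ∈ gradedPiece Q h l) :
    x * y ∈ gradedPiece Q h (k + l) := by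
  have h1 := Submodule.mul_mem_mul hx hy
  rw [gradedPiece, gradedPiece, Submodule.span_mul_span] at h1
  refine Submodule.span_le.2 ?_ h1
  rintro _ ⟨_, ⟨m, ⟨hm, rfl⟩, rfl⟩, _, ⟨m', ⟨hm', rfl⟩, rfl⟩, rfl⟩
  rw [SetLike.mem_coe]
  dsimp only
  rw [AddMonoidAlgebra.single_mul_single, ← map_add]
  exact single_mem_gradedPiece (hm.add hm') _

theorem one_mem_gradedPiece : (1 : AddMonoidAlgebra ℚ (Fin d → ℤ)) ∈ gradedPiece Q h 0 := by
  rw [AddMonoidAlgebra.one_def, ← map_zero h]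
  exact single_mem_gradedPiece inCone_zero _

theorem paramForm_mem_gradedPiece (hQ : ∀ v ∈ Q, h v = 1) (e : (Fin d → ℤ) → ℚ) (j : Fin d) :
    paramForm ℚ Q e j ∈ gradedPiece Q h 1 :=
  Submodule.sum_mem _ fun v hv => hQ v hv ▸ single_mem_gradedPiece (inCone_of_mem hv) _

theorem aeval_monomial_mem_gradedPiece {θ : Fin d → AddMonoidAlgebra ℚ (Fin d → ℤ)}
    (hθ : ∀ j, θ j ∈ gradedPiece Q h 1) (α : Fin d →₀ ℕ) (a : ℚ) :
    MvPolynomial.aeval θ (MvPolynomial.monomial α a) ∈ gradedPiece Q h α.degree := by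
  classical
  rw [MvPolynomial.aeval_monomial, ← Algebra.smul_def]
  refine Submodule.smul_mem _ _ ?_
  rw [Finsupp.prod, Finsupp.degree_apply, Nat.cast_sum]
  induction α.support using Finset.induction_on with
  | empty => simpa using one_mem_gradedPiece
  | insert j s hj ih =>
    rw [Finset.prod_insert hj, Finset.sum_insert hj]
    refine mul_mem_gradedPiece ?_ ih
    induction α j with
    | zero => simpa using one_mem_gradedPiece
    | succ n ih =>
      rw [pow_succ, Nat.cast_add, Nat.cast_one]
      exact mul_mem_gradedPiece ih (hθ j)

end gradedPiece

namespace IsTriangulation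

variable {d : ℕ} {Q : Finset (Fin d → ℤ)} {h : (Fin d → ℤ) →+ ℤ} {N : ℤ}
  {κ : (Fin d → ℤ) → ℕ} {Δ : Finset (Finset (Fin d → ℤ))}
  {c : Finset (Fin d → ℤ) → (Fin d → ℤ) → (Fin d → ℤ) →+ ℤ} {q : Fin d → ℤ}
  {B : Finset (Fin d → ℤ)} {τ : (Fin d → ℤ) → Finset (Fin d → ℤ)} {ℓ : ℕ}

theorem exists_box (ht : IsTriangulation Q N κ Δ c q)
    (hB : ∀ b, b ∈ B ↔ ∃ T ∈ Δ, IsBox T N (c T) q b)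
    (hτ : ∀ b ∈ B, τ b ∈ Δ ∧ IsBox (τ b) N (c (τ b)) q b) {x : Fin d → ℤ} (hx : InCone Q x) :
    ∃ b ∈ B, ∃ α : (Fin d → ℤ) → ℕ, x = b + ∑ v ∈ τ b, α v • v := by
  obtain ⟨T, hT, hpos⟩ := ht.exists_pos x hx
  obtain ⟨b, α, hb, hxb⟩ := hpos.exists_box (ht.dual T hT) (ht.generic T hT)
  have hbB : b ∈ B := (hB b).2 ⟨T, hT, hb⟩
  refine ⟨b, hbB, α, ?_⟩
  rwa [← ht.pos_unique hT (hτ b hbB).1 hb.pos (hτ b hbB).2.pos]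

/-- The box points generate the semigroup algebra over the linear system of parameters. -/
theorem exists_expansion (ht : IsTriangulation Q N κ Δ c q) (hQ : ∀ v ∈ Q, h v = 1)
    (hB : ∀ b, b ∈ B ↔ ∃ T ∈ Δ, IsBox T N (c T) q b)
    (hτ : ∀ b ∈ B, τ b ∈ Δ ∧ IsBox (τ b) N (c (τ b)) q b) (hp : ℓ.Prime) (hℓ : ¬ (ℓ : ℤ) ∣ N)
    {x : Fin d → ℤ} (hx : InCone Q x) :
    ∃ s : (Fin d → ℤ) → MvPolynomial (Fin d) ℚ,
      AddMonoidAlgebra.single x (1 : ℚ) = ∑ b ∈ B,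
        MvPolynomial.aeval (paramForm ℚ Q fun v => (ℓ : ℚ) ^ (N * κ v)) (s b) *
          AddMonoidAlgebra.single b (1 : ℚ) ∧
      ∀ b ∈ B, ∀ α ∈ (s b).support, (α.degree : ℤ) + h b = h x := by
  classical
  set θ := paramForm ℚ Q fun v => (ℓ : ℚ) ^ (N * κ v) with hθ
  have henum : ∀ T, ∃ e : Fin d → Fin d → ℤ, T ∈ Δ → (∀ i, e i ∈ T) ∧
      ∀ a : (Fin d → ℤ) → ℕ, ∑ v ∈ T, a v • v = ∑ i, a (e i) • e i := by
    intro T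
    by_cases hT : T ∈ Δ
    · let E := (T.equivFinOfCardEq (ht.dual T hT).card_eq).symm
      refine ⟨fun i => E i, fun _ => ⟨fun i => (E i).2, fun a => ?_⟩⟩
      rw [← Finset.sum_coe_sort T]
      exact (E.sum_comp fun v => a v • (v : Fin d → ℤ)).symm
    · exact ⟨0, fun h => absurd h hT⟩
  choose e he using henum
  have hfin := finite_inCone_level hQ (h x)
  have := hfin.fintype
  let C := {m | InCone Q m ∧ h m = h x}
  have hdec : ∀ m : C, ∃ b ∈ B, ∃ α : Fin d →₀ ℕ,
      (m : Fin d → ℤ) = b + ∑ i, α i • e (τ b) i := by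
    intro m
    obtain ⟨b, hb, α, hm⟩ := ht.exists_box hB hτ m.2.1
    refine ⟨b, hb, Finsupp.equivFunOnFinite.symm fun i => α (e (τ b) i), ?_⟩
    rw [hm, (he _ (hτ b hb).1).2]
    rfl
  choose b hb α hm using hdec
  have hinj : ∀ m m' : C, b m = b m' → α m = α m' → m = m' := by
    intro m m' h1 h2
    exact Subtype.ext (by rw [hm m, hm m', h1, h2])
  have hdeg : ∀ m : C, ((α m).degree : ℤ) + h (b m) = h x := by
    intro m
    rw [← m.2.2]
    conv_rhs => rw [hm m]
    rw [map_add, map_sum, add_comm, Finsupp.degree_eq_sum, Nat.cast_sum]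
    congr 1
    refine Finset.sum_congr rfl fun i _ => ?_
    have h1 := (he _ (hτ _ (hb m)).1).1 i
    rw [map_nsmul, hQ _ (ht.subset _ (hτ _ (hb m)).1 h1), nsmul_eq_mul, mul_one]
  let f : C → AddMonoidAlgebra ℚ (Fin d → ℤ) := fun m =>
    MvPolynomial.aeval θ (MvPolynomial.monomial (α m) (1 : ℚ)) * AddMonoidAlgebra.single (b m) 1
  let s : (C → ℚ) → (Fin d → ℤ) → MvPolynomial (Fin d) ℚ := fun g b' =>
    ∑ m with b m = b', MvPolynomial.monomial (α m) (g m)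
  have hs : ∀ g : C → ℚ, ∑ m, g m • f m =
      ∑ b' ∈ B, MvPolynomial.aeval θ (s g b') * AddMonoidAlgebra.single b' 1 := by
    intro g
    simp only [s, map_sum, Finset.sum_mul]
    rw [← Finset.sum_fiberwise_of_maps_to (s := Finset.univ) (t := B) (g := b) fun m _ => hb m]
    refine Finset.sum_congr rfl fun b' _ => Finset.sum_congr rfl fun m hm' => ?_
    rw [← (Finset.mem_filter.1 hm').2, ← smul_mul_assoc, ← map_smul, MvPolynomial.smul_monomial,
      smul_eq_mul, mul_one]
  have hind : LinearIndependent ℚ f := by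
    rw [Fintype.linearIndependent_iff]
    intro g hg m
    rw [hs] at hg
    have h1 := congrArg (MvPolynomial.coeff (α m)) (ht.eq_zero_of_aeval hτ hp hℓ hg (b m) (hb m))
    simp only [s, MvPolynomial.coeff_sum, MvPolynomial.coeff_monomial,
      MvPolynomial.coeff_zero] at h1
    rw [Finset.sum_eq_single m, if_pos rfl] at h1
    · exact h1
    · intro m' hm' hne
      exact if_neg fun h => hne (hinj m' m (Finset.mem_filter.1 hm').2 h)
    · intro h; simp at h
  have hfU : ∀ m, f m ∈ gradedPiece Q h (h x) := by
    intro m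
    rw [← hdeg m]
    refine mul_mem_gradedPiece (aeval_monomial_mem_gradedPiece
      (paramForm_mem_gradedPiece hQ _) _ _) (single_mem_gradedPiece ?_ _)
    have h1 := hτ _ (hb m)
    exact (ht.dual _ h1.1).inCone (ht.subset _ h1.1) fun v hv => h1.2.pos.nonneg hv
  have hUspan : gradedPiece Q h (h x) = Submodule.span ℚ
      (Set.range fun m : C => AddMonoidAlgebra.single (m : Fin d → ℤ) (1 : ℚ)) := by
    rw [gradedPiece, Set.image_eq_range]
  have : FiniteDimensional ℚ (gradedPiece Q h (h x)) := by
    rw [hUspan]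
    exact FiniteDimensional.span_of_finite ℚ (Set.finite_range _)
  have hspan : Submodule.span ℚ (Set.range f) = gradedPiece Q h (h x) := by
    refine Submodule.eq_of_le_of_finrank_le (Submodule.span_le.2 ?_) ?_
    · rintro _ ⟨m, rfl⟩; exact hfU m
    · rw [finrank_span_eq_card hind, hUspan]
      exact finrank_range_le_card _
  have hmem : AddMonoidAlgebra.single x (1 : ℚ) ∈ Submodule.span ℚ (Set.range f) := by
    rw [hspan]; exact single_mem_gradedPiece hx _
  obtain ⟨g, hg⟩ := (Submodule.mem_span_range_iff_exists_fun ℚ).1 hmem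
  refine ⟨s g, by rw [← hg, hs], fun b' _ α' hα' => ?_⟩
  obtain ⟨m, hm', hα⟩ := Finset.mem_biUnion.1 (Finset.mem_of_subset (MvPolynomial.support_sum) hα')
  have h1 := Finset.mem_of_subset MvPolynomial.support_monomial_subset hα
  rw [Finset.mem_singleton] at h1
  rw [h1, ← (Finset.mem_filter.1 hm').2]
  exact hdeg m

end IsTriangulation

section coeff

variable {d : ℕ} {Q : Finset (Fin d → ℤ)} {h : (Fin d → ℤ) →+ ℤ}

theorem coeff_eq_zero_of_not_inCone {k : ℤ} {y : AddMonoidAlgebra ℚ (Fin d → ℤ)}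
    (hy : y ∈ gradedPiece Q h k) {x : Fin d → ℤ} (hx : ¬ InCone Q x) : y.coeff x = 0 := by
  induction hy using Submodule.span_induction with
  | mem y hy =>
    obtain ⟨m, ⟨hm, -⟩, rfl⟩ := hy
    dsimp only
    rw [AddMonoidAlgebra.coeff_single, Finsupp.single_apply, if_neg]
    rintro rfl
    exact hx hm
  | zero => simp
  | add y z _ _ hy hz => rw [AddMonoidAlgebra.coeff_add, Finsupp.add_apply, hy, hz, add_zero]
  | smul a y _ hy => rw [AddMonoidAlgebra.coeff_smul, Finsupp.smul_apply, hy, smul_zero]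

theorem coeff_paramForm_mul {x : Fin d → ℤ} (hx : ∀ v ∈ Q, ¬ InCone Q (x - v))
    (e : (Fin d → ℤ) → ℚ) (j : Fin d) {k : ℤ} {y : AddMonoidAlgebra ℚ (Fin d → ℤ)}
    (hy : y ∈ gradedPiece Q h k) : (paramForm ℚ Q e j * y).coeff x = 0 := by
  rw [paramForm, Finset.sum_mul, AddMonoidAlgebra.coeff_sum, Finsupp.finsetSum_apply]
  refine Finset.sum_eq_zero fun v hv => ?_
  rw [AddMonoidAlgebra.coeff_single_mul_eq_mul_coeff (x - v)
    fun a _ => ⟨fun h => by rw [← h]; abel, fun h => by rw [h]; abel⟩,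
    coeff_eq_zero_of_not_inCone hy (hx v hv), mul_zero]

/-- Multiples of a parameter do not involve monomials that are not divisible by any generator. -/
theorem coeff_aeval_monomial_mul (hQ : ∀ v ∈ Q, h v = 1) {x : Fin d → ℤ}
    (hx : ∀ v ∈ Q, ¬ InCone Q (x - v)) (e : (Fin d → ℤ) → ℚ) {α : Fin d →₀ ℕ} (hα : α ≠ 0)
    (a : ℚ) {b : Fin d → ℤ} (hb : InCone Q b) :
    (MvPolynomial.aeval (paramForm ℚ Q e) (MvPolynomial.monomial α a) *
      AddMonoidAlgebra.single b (1 : ℚ)).coeff x = 0 := by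
  classical
  obtain ⟨j, hj⟩ := Finsupp.ne_iff.1 hα
  have h1 : MvPolynomial.monomial α a =
      MvPolynomial.X j * MvPolynomial.monomial (α - Finsupp.single j 1) a := by
    rw [MvPolynomial.X, MvPolynomial.monomial_mul, one_mul, add_tsub_cancel_of_le]
    rw [Finsupp.single_le_iff]
    exact Nat.one_le_iff_ne_zero.2 hj
  rw [h1, map_mul, MvPolynomial.aeval_X, mul_assoc]
  exact coeff_paramForm_mul hx e j (mul_mem_gradedPiece
    (aeval_monomial_mem_gradedPiece (paramForm_mem_gradedPiece hQ e) _ a)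
    (single_mem_gradedPiece hb _))

end coeff

namespace IsTriangulation

variable {d : ℕ} {Q : Finset (Fin d → ℤ)} {h : (Fin d → ℤ) →+ ℤ} {N : ℤ}
  {κ : (Fin d → ℤ) → ℕ} {Δ : Finset (Finset (Fin d → ℤ))}
  {c : Finset (Fin d → ℤ) → (Fin d → ℤ) → (Fin d → ℤ) →+ ℤ} {q : Fin d → ℤ}
  {B : Finset (Fin d → ℤ)} {τ : (Fin d → ℤ) → Finset (Fin d → ℤ)} {ℓ : ℕ}

theorem inCone_of_box (ht : IsTriangulation Q N κ Δ c q)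
    (hτ : ∀ b ∈ B, τ b ∈ Δ ∧ IsBox (τ b) N (c (τ b)) q b) {b : Fin d → ℤ} (hb : b ∈ B) :
    InCone Q b :=
  (ht.dual _ (hτ b hb).1).inCone (ht.subset _ (hτ b hb).1) fun _ hv => (hτ b hb).2.pos.nonneg hv

/-- Box points of level two inject into interior points by reflection. -/
theorem card_level_two_le (ht : IsTriangulation Q N κ Δ c q) (hQ : ∀ v ∈ Q, h v = 1)
    (hτ : ∀ b ∈ B, τ b ∈ Δ ∧ IsBox (τ b) N (c (τ b)) q b) {G : Finset (Fin d → ℤ)}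
    (hG : ∀ y, InInterior Q y → h y = d - 2 → y ∈ G) :
    (B.filter fun b => h b = 2).card ≤ G.card := by
  refine Finset.card_le_card_of_injOn (fun b => ∑ v ∈ τ b, v - b) (fun b hb => ?_) ?_
  · obtain ⟨hbB, hb2⟩ := Finset.mem_filter.1 hb
    obtain ⟨hT, hbox⟩ := hτ b hbB
    exact hG _ (ht.inInterior_of_pos_neg hT (hbox.pos_reflect (ht.dual _ hT)))
      (by rw [ht.level_reflect hQ hT, hb2])
  · intro b hb b' hb' heq
    obtain ⟨hT, hbox⟩ := hτ b (Finset.mem_filter.1 hb).1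
    obtain ⟨hT', hbox'⟩ := hτ b' (Finset.mem_filter.1 hb').1
    have h1 := hbox.pos_reflect (ht.dual _ hT)
    have h2 := hbox'.pos_reflect (ht.dual _ hT')
    dsimp only at heq
    rw [← heq] at h2
    rw [ht.pos_unique hT hT' h1 h2] at heq
    exact sub_right_injective heq

/-- Generators are either box points or among the vertices of one simplex. -/
theorem card_le_card_level_le_one (ht : IsTriangulation Q N κ Δ c q) (hQ : ∀ v ∈ Q, h v = 1)
    (hB : ∀ b, b ∈ B ↔ ∃ T ∈ Δ, IsBox T N (c T) q b)
    (hτ : ∀ b ∈ B, τ b ∈ Δ ∧ IsBox (τ b) N (c (τ b)) q b) :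
    Q.card + 1 ≤ d + (B.filter fun b => h b ≤ 1).card := by
  classical
  have h0B : (0 : Fin d → ℤ) ∈ B := by
    obtain ⟨T, hT, hpos⟩ := ht.exists_pos 0 inCone_zero
    refine (hB 0).2 ⟨T, hT, fun v hv => ?_⟩
    have h1 := (ht.dual T hT).pos
    rcases hpos v hv with h | h
    · simp at h
    · simp only [map_zero]
      exact ⟨le_rfl, h1.le, fun _ => h.2, fun h' => absurd h' h1.ne⟩
  have hsub : insert 0 (Q \ τ 0) ⊆ B.filter fun b => h b ≤ 1 := by
    intro v hv
    rcases Finset.mem_insert.1 hv with rfl | hv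
    · exact Finset.mem_filter.2 ⟨h0B, by simp⟩
    obtain ⟨hvQ, hvT⟩ := Finset.mem_sdiff.1 hv
    refine Finset.mem_filter.2 ⟨?_, (hQ v hvQ).le⟩
    obtain ⟨b, hb, α, hvb⟩ := ht.exists_box hB hτ (inCone_of_mem hvQ)
    obtain ⟨hT, hbox⟩ := hτ b hb
    have hlev : (1 : ℤ) = h b + ∑ u ∈ τ b, (α u : ℤ) := by
      rw [← hQ v hvQ, hvb, map_add, map_sum]
      congr 1
      refine Finset.sum_congr rfl fun u hu => ?_
      rw [map_nsmul, hQ u (ht.subset _ hT hu), nsmul_eq_mul, mul_one]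
    have hb0 := (ht.inCone_of_box hτ hb).level_nonneg hQ
    have hα : ∀ u ∈ τ b, α u = 0 := by
      intro u hu
      by_contra hne
      have h1 := Finset.add_sum_erase (τ b) (fun u => (α u : ℤ)) hu
      have h2 : 0 ≤ ∑ w ∈ (τ b).erase u, (α w : ℤ) := Finset.sum_nonneg fun w _ => by positivity
      have hu1 : α u = 1 := by omega
      have h3 : ∑ w ∈ (τ b).erase u, (α w : ℤ) = 0 := by omega
      have h4 := (Finset.sum_eq_zero_iff_of_nonneg fun w _ => by positivity).1 h3
      have hb00 := ht.level_zero_box hQ hT hbox (by omega)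
      apply hvT
      rw [hvb, Finset.sum_eq_single u, hu1, one_smul, hb00, zero_add, ← hb00]
      · exact hu
      · intro w hw hwu
        rw [Int.natCast_eq_zero.1 (h4 w (Finset.mem_erase.2 ⟨hwu, hw⟩)), zero_smul]
      · exact fun h => absurd hu h
    rw [hvb, Finset.sum_eq_zero fun u hu => by rw [hα u hu, zero_smul], add_zero]
    exact hb
  have h1 := Finset.card_le_card hsub
  have h2 := Finset.le_card_sdiff (τ 0) Q
  rw [Finset.card_insert_of_notMem fun hm => by
    have := hQ 0 (Finset.mem_sdiff.1 hm).1
    simp at this] at h1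
  rw [(ht.dual _ (hτ 0 h0B).1).card_eq] at h2
  omega

theorem two_mul_card_level_le_one (ht : IsTriangulation Q N κ Δ c q) (hQ : ∀ v ∈ Q, h v = 1)
    (hB : ∀ b, b ∈ B ↔ ∃ T ∈ Δ, IsBox T N (c T) q b)
    (hτ : ∀ b ∈ B, τ b ∈ Δ ∧ IsBox (τ b) N (c (τ b)) q b) (hp : ℓ.Prime) (hℓ : ¬ (ℓ : ℤ) ∣ N)
    (hone : ∀ m, InCone Q m → h m = 1 → m ∈ Q) {x : Fin d → ℤ} (hxB : x ∈ B) (hx2 : h x = 2)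
    (hx : ∀ v ∈ Q, ¬ InCone Q (x - v)) :
    2 * (B.filter fun b => h b ≤ 1).card ≤ B.card := by
  classical
  set θ := paramForm ℚ Q fun v => (ℓ : ℚ) ^ (N * κ v) with hθ
  let _ : Algebra (MvPolynomial (Fin d) ℚ) (AddMonoidAlgebra ℚ (Fin d → ℤ)) :=
    (MvPolynomial.aeval θ).toRingHom.toAlgebra
  have hsmul : ∀ (s : MvPolynomial (Fin d) ℚ) (y : AddMonoidAlgebra ℚ (Fin d → ℤ)),
      s • y = MvPolynomial.aeval θ s * y := fun s y => Algebra.smul_def s y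
  have hC : ∀ b : B, InCone Q b.1 := fun b => ht.inCone_of_box hτ b.2
  choose p hp1 hp2 using fun b b' : B =>
    ht.exists_expansion hQ hB hτ hp hℓ ((hC b).add (hC b'))
  let X : B → AddMonoidAlgebra ℚ (Fin d → ℤ) := fun b => AddMonoidAlgebra.single b.1 1
  have hind : LinearIndependent (MvPolynomial (Fin d) ℚ) X := by
    rw [Fintype.linearIndependent_iff]
    intro s hs b
    have h1 := ht.eq_zero_of_aeval hτ hp hℓ (s := fun b => if hb : b ∈ B then s ⟨b, hb⟩ else 0) (by
      rw [← hs, ← Finset.sum_coe_sort B]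
      exact Finset.sum_congr rfl fun b _ => by rw [hsmul, dif_pos b.2]) b b.2
    rwa [dif_pos b.2] at h1
  have key : ∀ b b' : B, h b ≤ 1 → h b' ≤ 1 → p b b' x = 0 := by
    intro b b' hb hb'
    have hle : ∀ α ∈ (p b b' x).support, α = 0 ∧ h b = 1 ∧ h b' = 1 := by
      intro α hα
      have h1 := hp2 b b' x hxB α hα
      rw [hx2, map_add] at h1
      exact ⟨(Finsupp.degree_eq_zero_iff α).1 (by omega), by omega, by omega⟩
    ext α
    rw [MvPolynomial.coeff_zero]
    by_contra hne
    obtain ⟨rfl, h1, h1'⟩ := hle α (MvPolynomial.mem_support_iff.2 hne)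
    have hC0 : p b b' x = MvPolynomial.C ((p b b' x).coeff 0) := by
      ext α
      rw [MvPolynomial.coeff_C]
      split_ifs with h
      · rw [h]
      · by_contra hne
        exact h (hle α (MvPolynomial.mem_support_iff.2 hne)).1.symm
    have hcoeff := congrArg (fun y => y.coeff x) (hp1 b b')
    simp only [AddMonoidAlgebra.coeff_sum, Finsupp.finsetSum_apply] at hcoeff
    rw [AddMonoidAlgebra.coeff_single, Finsupp.single_apply, if_neg fun heq => ?_,
      Finset.sum_eq_single x, hC0, MvPolynomial.aeval_C, ← Algebra.smul_def,
      AddMonoidAlgebra.smul_single, AddMonoidAlgebra.coeff_single, Finsupp.single_eq_same,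
      smul_eq_mul, mul_one] at hcoeff
    · exact hne hcoeff.symm
    · intro b'' hb'' hne''
      rw [(p b b' b'').as_sum, map_sum, Finset.sum_mul, AddMonoidAlgebra.coeff_sum,
        Finsupp.finsetSum_apply]
      refine Finset.sum_eq_zero fun α _ => ?_
      by_cases hα : α = 0
      · rw [hα, ← MvPolynomial.C_apply, MvPolynomial.aeval_C, ← Algebra.smul_def,
          AddMonoidAlgebra.smul_single, AddMonoidAlgebra.coeff_single, Finsupp.single_apply,
          if_neg hne'']
      · exact coeff_aeval_monomial_mul hQ hx _ hα _ (ht.inCone_of_box hτ hb'')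
    · exact fun h => absurd hxB h
    · refine hx b (hone b (hC b) h1) ?_
      rw [← heq, add_sub_cancel_left]
      exact hC b'
  have h1 := two_mul_card_le_of_isotropic X hind (fun b b' k => p b b' k) (fun b b' => by
    simp only [X, AddMonoidAlgebra.single_mul_single, mul_one]
    rw [hp1, ← Finset.sum_coe_sort B]
    exact Finset.sum_congr rfl fun k _ => (hsmul _ _).symm)
    (Finset.univ.filter fun b : B => h b ≤ 1) ⟨x, hxB⟩ (fun b hb b' hb' =>
      key b b' (Finset.mem_filter.1 hb).2 (Finset.mem_filter.1 hb').2)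
  rw [Fintype.card_coe] at h1
  refine le_trans (Nat.mul_le_mul_left 2 ?_) h1
  refine Finset.card_le_card_of_surjOn (fun b : B => b.1) fun b hb => ?_
  obtain ⟨hbB, hb1⟩ := Finset.mem_filter.1 hb
  exact ⟨⟨b, hbB⟩, by simpa using hb1, rfl⟩

end IsTriangulation

/-- The semigroup of lattice points of the cone is generated in degree one, provided that there
are sufficiently many generators compared to the interior points of degree `d - 2`. -/
theorem exists_inCone_sub {d : ℕ} {Q G : Finset (Fin d → ℤ)} {h : (Fin d → ℤ) →+ ℤ} (hd : 0 < d)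
    (hQ : ∀ v ∈ Q, h v = 1) (hspan : Submodule.span ℝ (toReal '' (Q : Set (Fin d → ℤ))) = ⊤)
    (hone : ∀ m, InCone Q m → h m = 1 → m ∈ Q) (hempty : ∀ y, InInterior Q y → h y ≠ d - 3)
    (hG : ∀ y, InInterior Q y → h y = d - 2 → y ∈ G) (hcard : d + G.card ≤ Q.card)
    {x : Fin d → ℤ} (hx : InCone Q x) (hx2 : 2 ≤ h x) : ∃ v ∈ Q, InCone Q (x - v) := by
  classical
  obtain ⟨N, κ, Δ, c, q, ht⟩ := exists_isTriangulation hQ hspan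
  have hfin : {b | ∃ T ∈ Δ, IsBox T N (c T) q b}.Finite := by
    refine (((finite_inCone_level hQ 0).union (finite_inCone_level hQ 1)).union
      (finite_inCone_level hQ 2)).subset ?_
    rintro b ⟨T, hT, hb⟩
    have h1 := (ht.dual T hT).inCone (ht.subset T hT) fun v hv => hb.pos.nonneg hv
    have h2 := h1.level_nonneg hQ
    have h3 := ht.level_box_le hQ hd hempty hT hb
    have h4 : h b = 0 ∨ h b = 1 ∨ h b = 2 := by omega
    rcases h4 with h4 | h4 | h4
    · exact Or.inl (Or.inl ⟨h1, h4⟩)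
    · exact Or.inl (Or.inr ⟨h1, h4⟩)
    · exact Or.inr ⟨h1, h4⟩
  set B := hfin.toFinset
  have hB : ∀ b, b ∈ B ↔ ∃ T ∈ Δ, IsBox T N (c T) q b := fun b => hfin.mem_toFinset
  have hchoice : ∀ b, ∃ T, b ∈ B → T ∈ Δ ∧ IsBox T N (c T) q b := by
    intro b
    by_cases hb : b ∈ B
    · obtain ⟨T, hT⟩ := (hB b).1 hb
      exact ⟨T, fun _ => hT⟩
    · exact ⟨∅, fun h => absurd h hb⟩
  choose τ hτ using hchoice
  obtain ⟨b, hb, α, hxb⟩ := ht.exists_box hB hτ hx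
  obtain ⟨hT, hbox⟩ := hτ b hb
  by_cases hα : ∃ v ∈ τ b, α v ≠ 0
  · obtain ⟨v, hv, hα⟩ := hα
    refine ⟨v, ht.subset _ hT hv, ?_⟩
    have h1 : x - v = b + ((α v - 1) • v + ∑ u ∈ (τ b).erase v, α u • u) := by
      rw [hxb, ← Finset.add_sum_erase _ _ hv]
      nth_rewrite 1 [← Nat.sub_add_cancel (Nat.one_le_iff_ne_zero.2 hα)]
      rw [succ_nsmul]
      abel
    rw [h1]
    have hcone : ∀ u ∈ τ b, ∀ k : ℕ, InCone Q (k • u) := fun u hu k =>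
      inCone_nsmul (inCone_of_mem (ht.subset _ hT hu)) k
    exact (ht.inCone_of_box hτ hb).add ((hcone v hv _).add
      (inCone_sum fun u hu => hcone u (Finset.mem_of_mem_erase hu) _))
  · push Not at hα
    rw [Finset.sum_eq_zero fun u hu => by rw [hα u hu, zero_smul], add_zero] at hxb
    subst hxb
    have hx2' : h x = 2 := le_antisymm (ht.level_box_le hQ hd hempty hT hbox) hx2
    by_contra! hcontra
    obtain ⟨ℓ, hℓ, hp⟩ := Nat.exists_infinite_primes (N.natAbs + 1)
    have hN := (ht.dual _ hT).pos
    have hdvd : ¬ (ℓ : ℤ) ∣ N := fun hdvd => by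
      have := Int.le_of_dvd hN hdvd
      omega
    have h1 := ht.two_mul_card_level_le_one hQ hB hτ hp hdvd hone hb hx2' hcontra
    have h2 := ht.card_le_card_level_le_one hQ hB hτ
    have h3 := ht.card_level_two_le hQ hτ hG
    have h4 := Finset.card_filter_add_card_filter_not (s := B) (fun b => h b ≤ 1)
    have h5 : (B.filter fun b => ¬ h b ≤ 1).card ≤ (B.filter fun b => h b = 2).card := by
      refine Finset.card_le_card fun b hb => ?_
      obtain ⟨hbB, hb1⟩ := Finset.mem_filter.1 hb
      have := ht.level_box_le hQ hd hempty (hτ b hbB).1 (hτ b hbB).2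
      exact Finset.mem_filter.2 ⟨hbB, by omega⟩
    omega

theorem toReal_vecCons {n : ℕ} (k : ℤ) (z : Fin n → ℤ) :
    toReal (Matrix.vecCons k z) = Matrix.vecCons (k : ℝ) (toReal z) := by
  funext i
  refine Fin.cases ?_ (fun i => ?_) i <;> simp [toReal]

theorem lat_eq_range (n : ℕ) : lat n = Set.range (toReal (d := n)) := by
  ext x
  constructor
  · intro hx
    choose z hz using hx
    exact ⟨z, funext fun i => (hz i).symm⟩
  · rintro ⟨z, rfl⟩ i
    exact ⟨z i, rfl⟩

theorem finite_toReal_preimage {n : ℕ} {A : Set (Fin n → ℝ)} (hA : Bornology.IsBounded A) :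
    {z | toReal z ∈ A}.Finite := by
  obtain ⟨R, hR⟩ := hA.exists_norm_le
  refine (Set.finite_Icc (fun _ : Fin n => -⌈R⌉) (fun _ => ⌈R⌉)).subset fun z hz => ?_
  have h1 : ∀ i, |z i| ≤ ⌈R⌉ := by
    intro i
    have h2 := (norm_le_pi_norm (toReal z) i).trans (hR _ hz)
    have h3 := h2.trans (Int.le_ceil R)
    rw [toReal, Real.norm_eq_abs] at h3
    exact_mod_cast h3
  exact ⟨fun i => (abs_le.1 (h1 i)).1, fun i => (abs_le.1 (h1 i)).2⟩

theorem ncard_inter_lat {n : ℕ} {A : Set (Fin n → ℝ)} (hA : {z | toReal z ∈ A}.Finite) :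
    (A ∩ lat n).ncard = hA.toFinset.card := by
  have h1 : A ∩ lat n = toReal '' {z | toReal z ∈ A} := by
    rw [lat_eq_range, ← Set.image_preimage_eq_inter_range]
    rfl
  rw [h1, Set.ncard_image_of_injective _ toReal_injective, Set.ncard_eq_toFinset_card _ hA]

/-- The lattice points of `P`, placed at height one. -/
structure IsLift {n : ℕ} (P : Set (Fin n → ℝ)) (Q : Finset (Fin (n + 1) → ℤ)) : Prop where
  polytope : IsLatticePolytope n P
  mem_iff : ∀ m, m ∈ Q ↔ ∃ z, m = Matrix.vecCons 1 z ∧ toReal z ∈ P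

namespace IsLift

variable {n : ℕ} {P : Set (Fin n → ℝ)} {Q : Finset (Fin (n + 1) → ℤ)}

theorem convex (hQ : IsLift P Q) : Convex ℝ P := by
  obtain ⟨⟨S, -, rfl⟩, -⟩ := hQ.polytope
  exact convex_convexHull ℝ _

theorem level_eq_one (hQ : IsLift P Q) {v : Fin (n + 1) → ℤ} (hv : v ∈ Q) :
    Pi.evalAddMonoidHom (fun _ => ℤ) (0 : Fin (n + 1)) v = 1 := by
  obtain ⟨z, rfl, -⟩ := (hQ.mem_iff v).1 hv
  simp

theorem exists_combination (hQ : IsLift P Q) {p : Fin n → ℝ} (hp : p ∈ P) :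
    ∃ ρ : (Fin (n + 1) → ℤ) → ℝ, (∀ v, 0 ≤ ρ v) ∧
      Matrix.vecCons 1 p = ∑ v ∈ Q, ρ v • toReal v := by
  classical
  obtain ⟨⟨S, -, hS⟩, -⟩ := hQ.polytope
  have hS' := hS
  rw [hS] at hp
  refine convexHull_min (t := {p | ∃ ρ : (Fin (n + 1) → ℤ) → ℝ, (∀ v, 0 ≤ ρ v) ∧
      Matrix.vecCons 1 p = ∑ v ∈ Q, ρ v • toReal v}) ?_ ?_ hp
  · rintro _ ⟨z, hz, rfl⟩
    have hzQ : Matrix.vecCons 1 z ∈ Q := by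
      refine (hQ.mem_iff _).2 ⟨z, rfl, ?_⟩
      rw [hS]
      exact subset_convexHull ℝ _ ⟨z, hz, rfl⟩
    obtain ⟨ρ, h1, h2⟩ := inCone_of_mem hzQ
    rw [toReal_vecCons, Int.cast_one] at h2
    exact ⟨ρ, h1, h2⟩
  · rintro p ⟨ρ, h1, h2⟩ p' ⟨ρ', h1', h2'⟩ a b ha hb hab
    refine ⟨a • ρ + b • ρ', fun v => add_nonneg (mul_nonneg ha (h1 v)) (mul_nonneg hb (h1' v)), ?_⟩
    have h3 : Matrix.vecCons 1 (a • p + b • p') =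
        a • Matrix.vecCons 1 p + b • Matrix.vecCons 1 p' := by
      rw [Matrix.smul_cons, Matrix.smul_cons, Matrix.cons_add_cons, smul_eq_mul, smul_eq_mul,
        mul_one, mul_one, hab]
    rw [h3, h2, h2', Finset.smul_sum, Finset.smul_sum, ← Finset.sum_add_distrib]
    refine Finset.sum_congr rfl fun v _ => ?_
    rw [Pi.add_apply, add_smul, smul_smul, smul_smul]
    rfl

theorem mem_dilate_of_combination (hQ : IsLift P Q) {k : ℕ} (hk : 1 ≤ k) {y : Fin n → ℝ}
    {ρ : (Fin (n + 1) → ℤ) → ℝ} (hρ : ∀ v ∈ Q, 0 ≤ ρ v)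
    (hy : Matrix.vecCons (k : ℝ) y = ∑ v ∈ Q, ρ v • toReal v) : y ∈ dilate n k P := by
  have hk0 : (k : ℝ) ≠ 0 := by positivity
  have h0 := congrFun hy 0
  have hsum : ∑ v ∈ Q, ρ v = k := by
    rw [Matrix.cons_val_zero, Finset.sum_apply] at h0
    rw [h0]
    refine Finset.sum_congr rfl fun v hv => ?_
    have h1 : v 0 = 1 := hQ.level_eq_one hv
    simp [toReal, h1]
  have hy' : y = ∑ v ∈ Q, ρ v • Matrix.vecTail (toReal v) := by
    funext i
    have h1 := congrFun hy i.succ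
    simpa [Matrix.vecTail] using h1
  refine ⟨∑ v ∈ Q, (ρ v / k) • Matrix.vecTail (toReal v), ?_, ?_⟩
  · refine hQ.convex.sum_mem (fun v hv => div_nonneg (hρ v hv) k.cast_nonneg) ?_ fun v hv => ?_
    · rw [← Finset.sum_div, hsum, div_self hk0]
    · obtain ⟨z, rfl, hz⟩ := (hQ.mem_iff v).1 hv
      rwa [toReal_vecCons, Matrix.tail_cons]
  · dsimp only
    rw [hy', Finset.smul_sum]
    refine Finset.sum_congr rfl fun v _ => ?_
    rw [smul_smul, mul_div_cancel₀ _ hk0]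

theorem inCone_iff (hQ : IsLift P Q) {k : ℕ} (hk : 1 ≤ k) {z : Fin n → ℤ} :
    InCone Q (Matrix.vecCons (k : ℤ) z) ↔ toReal z ∈ dilate n k P := by
  constructor
  · rintro ⟨ρ, h1, h2⟩
    rw [toReal_vecCons, Int.cast_natCast] at h2
    exact hQ.mem_dilate_of_combination hk (fun v _ => h1 v) h2
  · rintro ⟨p, hp, hpz⟩
    obtain ⟨ρ, h1, h2⟩ := hQ.exists_combination hp
    refine ⟨(k : ℝ) • ρ, fun v => mul_nonneg k.cast_nonneg (h1 v), ?_⟩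
    dsimp only at hpz
    rw [toReal_vecCons, ← hpz, Int.cast_natCast]
    have h3 : Matrix.vecCons (k : ℝ) ((k : ℝ) • p) = (k : ℝ) • Matrix.vecCons 1 p := by
      rw [Matrix.smul_cons, smul_eq_mul, mul_one]
    rw [h3, h2, Finset.smul_sum]
    exact Finset.sum_congr rfl fun v _ => smul_smul _ _ _

theorem span_eq_top (hQ : IsLift P Q) :
    Submodule.span ℝ (toReal '' (Q : Set (Fin (n + 1) → ℤ))) = ⊤ := by
  set W := Submodule.span ℝ (toReal '' (Q : Set (Fin (n + 1) → ℤ)))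
  let A : AffineSubspace ℝ (Fin n → ℝ) :=
    { carrier := {p | Matrix.vecCons 1 p ∈ W}
      smul_vsub_vadd_mem' := by
        intro a p₁ p₂ p₃ h₁ h₂ h₃
        have h4 : (Matrix.vecCons 1 (a • (p₁ - p₂) + p₃) : Fin (n + 1) → ℝ) =
            a • (Matrix.vecCons 1 p₁ - Matrix.vecCons 1 p₂) + Matrix.vecCons 1 p₃ := by
          simp [Matrix.smul_cons]
        have h5 := W.add_mem (W.smul_mem a (W.sub_mem h₁ h₂)) h₃
        rw [← h4] at h5
        exact h5 }
  have hPA : P ⊆ A := by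
    intro p hp
    obtain ⟨ρ, -, h2⟩ := hQ.exists_combination hp
    change Matrix.vecCons 1 p ∈ W
    rw [h2]
    exact W.sum_mem fun v hv => W.smul_mem _ (Submodule.subset_span ⟨v, hv, rfl⟩)
  have hA : ∀ p, Matrix.vecCons 1 p ∈ W := by
    have h1 := affineSpan_le.2 hPA
    rw [hQ.polytope.2, top_le_iff] at h1
    intro p
    have h2 : p ∈ A := by rw [h1]; exact AffineSubspace.mem_top ℝ _ p
    exact h2
  refine eq_top_iff.2 fun y _ => ?_
  have h1 : y = y 0 • Matrix.vecCons 1 0 +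
      (Matrix.vecCons 1 (Matrix.vecTail y) - Matrix.vecCons 1 0) := by
    funext i
    refine Fin.cases ?_ (fun i => ?_) i <;> simp [Matrix.vecTail]
  rw [h1]
  exact W.add_mem (W.smul_mem _ (hA 0)) (W.sub_mem (hA _) (hA 0))

theorem mem_interior_of_inInterior (hQ : IsLift P Q) {k : ℕ} (hk : 1 ≤ k) {z : Fin n → ℤ}
    (hz : InInterior Q (Matrix.vecCons (k : ℤ) z)) : toReal z ∈ interior (dilate n k P) := by
  let L : (Q → ℝ) →ₗ[ℝ] (Fin (n + 1) → ℝ) := Fintype.linearCombination ℝ fun v : Q => toReal v.1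
  have hL : ∀ ρ, L ρ = ∑ v : Q, ρ v • toReal v.1 := fun ρ => Fintype.linearCombination_apply ..
  have hsurj : Function.Surjective L := by
    rw [← LinearMap.range_eq_top, Fintype.range_linearCombination, ← hQ.span_eq_top]
    congr 1
    ext y
    simp
  have hU : IsOpen (Set.univ.pi fun _ : Q => Set.Ioi (0 : ℝ)) :=
    isOpen_set_pi Set.finite_univ fun _ _ => isOpen_Ioi
  have hcont : Continuous fun y : Fin n → ℝ => (Matrix.vecCons (k : ℝ) y : Fin (n + 1) → ℝ) :=
    continuous_const.matrixVecCons continuous_id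
  have hV := (L.isOpenMap_of_finiteDimensional hsurj _ hU).preimage hcont
  refine mem_interior.2 ⟨_, ?_, hV, ?_⟩
  · rintro y ⟨ρ, h1, h2⟩
    refine hQ.mem_dilate_of_combination (ρ := fun v => if hv : v ∈ Q then ρ ⟨v, hv⟩ else 0) hk
      (fun v hv => ?_) ?_
    · rw [dif_pos hv]
      exact (h1 ⟨v, hv⟩ trivial).le
    · dsimp only at h2
      rw [← h2, hL, ← Finset.sum_coe_sort Q]
      exact Finset.sum_congr rfl fun v _ => by rw [dif_pos v.2]
  · obtain ⟨ρ, h1, h2⟩ := hz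
    refine ⟨fun v => ρ v, fun v _ => h1 v, ?_⟩
    rw [hL, Finset.sum_coe_sort Q fun v => ρ v • toReal v, ← h2, toReal_vecCons,
      Int.cast_natCast]

end IsLift

/-- For `n ≥ 3`, if `(n-2)P` has no interior lattice points, `g` is the number of
interior lattice points of `(n-1)P`, and `P` has at least `n + g + 1` lattice points,
then `P` is normal. -/
theorem normal_of_genus_bound (n : ℕ) (hn : 3 ≤ n) (P : Set (Fin n → ℝ))
    (hP : IsLatticePolytope n P)
    (hempty : interior (dilate n (n - 2) P) ∩ lat n = ∅)
    (g : ℕ) (hg : g = (interior (dilate n (n - 1) P) ∩ lat n).ncard)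
    (hcard : n + g + 1 ≤ (P ∩ lat n).ncard) :
    ∀ k : ℕ, 1 ≤ k →
      (dilate n k P ∩ lat n) + (P ∩ lat n) = dilate n (k + 1) P ∩ lat n := by 
  classical
  have hbdd : ∀ k, Bornology.IsBounded (dilate n k P) := by
    intro k
    obtain ⟨⟨S, -, rfl⟩, -⟩ := hP
    exact ((S.finite_toSet.image _).isCompact_convexHull ℝ |>.image
      (continuous_const_smul (k : ℝ))).isBounded
  have hdilate : dilate n 1 P = P := by simp [dilate]
  have hfin : {z | toReal z ∈ P}.Finite := finite_toReal_preimage (hdilate ▸ hbdd 1)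
  have hfinG : {z | toReal z ∈ interior (dilate n (n - 1) P)}.Finite :=
    finite_toReal_preimage ((hbdd _).subset interior_subset)
  have hinj : ∀ k : ℤ, Function.Injective
      (Matrix.vecCons k : (Fin n → ℤ) → Fin (n + 1) → ℤ) := fun k x y hxy => by
    simpa using congrArg Matrix.vecTail hxy
  let Q : Finset (Fin (n + 1) → ℤ) := hfin.toFinset.image (Matrix.vecCons 1)
  let G : Finset (Fin (n + 1) → ℤ) := hfinG.toFinset.image (Matrix.vecCons ((n - 1 : ℕ) : ℤ))
  have hQ : IsLift P Q := by
    refine ⟨hP, fun m => ?_⟩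
    simp only [Q, Finset.mem_image, Set.Finite.mem_toFinset, Set.mem_ofPred_eq]
    exact ⟨fun ⟨z, h1, h2⟩ => ⟨z, h2.symm, h1⟩, fun ⟨z, h1, h2⟩ => ⟨z, h2, h1.symm⟩⟩
  have hform : ∀ (m : Fin (n + 1) → ℤ) (k : ℤ),
      Pi.evalAddMonoidHom (fun _ => ℤ) (0 : Fin (n + 1)) m = k →
        m = Matrix.vecCons k (Matrix.vecTail m) := by
    rintro m _ rfl
    exact (Matrix.cons_head_tail m).symm
  have hmem : ∀ (k : ℕ) (z : Fin n → ℤ), 1 ≤ k →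
      (toReal z ∈ dilate n k P ∩ lat n ↔ InCone Q (Matrix.vecCons (k : ℤ) z)) := by
    intro k z hk
    rw [hQ.inCone_iff hk, lat_eq_range]
    exact and_iff_left ⟨z, rfl⟩
  have hmemP : ∀ z : Fin n → ℤ, toReal z ∈ P ∩ lat n ↔ InCone Q (Matrix.vecCons 1 z) := by
    intro z
    have := hmem 1 z le_rfl
    rwa [hdilate, Nat.cast_one] at this
  have hone : ∀ m, InCone Q m → Pi.evalAddMonoidHom (fun _ => ℤ) (0 : Fin (n + 1)) m = 1 →
      m ∈ Q := by
    intro m hm h1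
    have h2 := hform m 1 h1
    rw [h2] at hm
    exact (hQ.mem_iff m).2 ⟨_, h2, ((hmemP _).2 hm).1⟩
  intro k hk
  ext x
  constructor
  · rintro ⟨_, hy, _, hz, rfl⟩
    have hy' := hy.2
    have hz' := hz.2
    rw [lat_eq_range] at hy' hz'
    obtain ⟨y, rfl⟩ := hy'
    obtain ⟨z, rfl⟩ := hz'
    have h1 := ((hmem k y hk).1 hy).add ((hmemP z).1 hz)
    rw [Matrix.cons_add_cons, ← Nat.cast_succ] at h1
    dsimp only
    rw [← toReal_add]
    exact (hmem (k + 1) _ (by omega)).2 h1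
  · intro hx
    have hx' := hx.2
    rw [lat_eq_range] at hx'
    obtain ⟨x, rfl⟩ := hx'
    obtain ⟨v, hv, hxv⟩ : ∃ v ∈ Q, InCone Q (Matrix.vecCons ((k + 1 : ℕ) : ℤ) x - v) := by
      refine exists_inCone_sub (G := G) (by omega) (fun v hv => hQ.level_eq_one hv)
        hQ.span_eq_top hone (fun y hy hlev => ?_) (fun y hy hlev => ?_) ?_
        ((hmem (k + 1) x (by omega)).1 hx)
        (by rw [Pi.evalAddMonoidHom_apply, Matrix.cons_val_zero]; omega)
      · have h1 := hform y ((n - 2 : ℕ) : ℤ) (by rw [hlev]; push_cast; omega)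
        rw [h1] at hy
        have h2 := hQ.mem_interior_of_inInterior (by omega) hy
        have h3 : toReal (Matrix.vecTail y) ∈ interior (dilate n (n - 2) P) ∩ lat n :=
          ⟨h2, by rw [lat_eq_range]; exact ⟨_, rfl⟩⟩
        rw [hempty] at h3
        exact h3
      · have h1 := hform y ((n - 1 : ℕ) : ℤ) (by rw [hlev]; push_cast; omega)
        rw [h1] at hy ⊢
        exact Finset.mem_image_of_mem _
          (hfinG.mem_toFinset.2 (hQ.mem_interior_of_inInterior (by omega) hy))
      · rw [ncard_inter_lat hfinG] at hg
        rw [ncard_inter_lat hfin] at hcard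
        rw [Finset.card_image_of_injective _ (hinj _), Finset.card_image_of_injective _ (hinj _)]
        omega
    obtain ⟨w, rfl, hw⟩ := (hQ.mem_iff v).1 hv
    have h1 : Matrix.vecCons ((k + 1 : ℕ) : ℤ) x - Matrix.vecCons 1 w =
        Matrix.vecCons (k : ℤ) (x - w) := by
      rw [Matrix.cons_sub_cons]
      congr 1
      push_cast
      ring
    rw [h1] at hxv
    refine ⟨_, (hmem k _ hk).2 hxv, _, (hmemP w).2 (inCone_of_mem hv), ?_⟩
    dsimp only
    rw [← toReal_add, sub_add_cancel]
end
end

section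
/- Let n ≥ 3 and let D ⊆ ℝⁿ be a lattice n-polytope which is a pyramid, such that D ∩ ℤⁿ has exactly n+1 elements and the topological interior of the dilate (n−1)D contains exactly one point of ℤⁿ. Then D is unimodularly equivalent to D_n: there exist A ∈ GL(n, ℤ) and b ∈ ℤⁿ such that the affine map x ↦ A·x + b carries D onto D_n. -/
open Set Pointwise

noncomputable section

/-- A group `Λ` of weights containing the integral weights, with integral sums, whose only
nonnegative members of sum one are the unit weights, and with a single positive member of sum
`n - 1`, is generated by the integral weights and half the indicator of a set of four indices. -/
lemma exists_half_indicator {ι : Type*} [Fintype ι] [DecidableEq ι] (n : ℕ) (hn : 3 ≤ n)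
    (hι : Fintype.card ι = n + 1) (Λ : AddSubgroup (ι → ℝ))
    (hZ : ∀ i, Pi.single i (1 : ℝ) ∈ Λ) (hsum : ∀ c ∈ Λ, ∃ z : ℤ, ∑ i, c i = z)
    (hempty : ∀ c ∈ Λ, (∀ i, 0 ≤ c i) → ∑ i, c i = 1 → ∃ i, c = Pi.single i (1 : ℝ))
    (hone : ∃ m, ∀ c, (c ∈ Λ ∧ (∀ i, 0 < c i) ∧ ∑ i, c i = (n : ℝ) - 1) ↔ c = m) :
    ∃ T : Finset ι, T.card = 4 ∧ (fun i => if i ∈ T then (1 / 2 : ℝ) else 0) ∈ Λ ∧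
      ∀ c ∈ Λ, (∃ z : ι → ℤ, ∀ i, c i = z i) ∨
        ∃ z : ι → ℤ, ∀ i, c i = z i + if i ∈ T then (1 / 2 : ℝ) else 0 := by
  obtain ⟨m, hm⟩ := hone
  have hint : ∀ z : ι → ℤ, (fun i => (z i : ℝ)) ∈ Λ := by
    intro z
    have : (fun i => (z i : ℝ)) = ∑ i, z i • (Pi.single i (1 : ℝ) : ι → ℝ) := by
      ext j
      simp [Finset.sum_apply, Pi.single_apply]
    rw [this]
    exact Λ.sum_mem fun i _ => Λ.zsmul_mem (hZ i) _
  have hfr : ∀ c ∈ Λ, (fun i => Int.fract (c i)) ∈ Λ := by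
    intro c hc
    have := Λ.sub_mem hc (hint fun i => ⌊c i⌋)
    exact this
  have hcard : (Fintype.card ι : ℝ) = n + 1 := by rw [hι]; push_cast; rfl
  have key : ∀ c ∈ Λ, (∃ i, Int.fract (c i) ≠ 0) →
      (∀ i, Int.fract (c i) = 1 - m i) ∧ ∑ i, Int.fract (c i) = 2 := by
    rintro c hc ⟨k, hk⟩
    obtain ⟨h, hh⟩ := hsum _ (hfr c hc)
    have hpos : 0 < ∑ i, Int.fract (c i) :=
      Finset.sum_pos' (fun i _ => Int.fract_nonneg _)
        ⟨k, Finset.mem_univ _, lt_of_le_of_ne (Int.fract_nonneg _) (Ne.symm hk)⟩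
    have h1 : h ≠ 1 := by
      rintro rfl
      obtain ⟨i, hi⟩ := hempty _ (hfr c hc) (fun i => Int.fract_nonneg _) (by simpa using hh)
      have := congrFun hi i
      simp only [Pi.single_eq_same] at this
      exact (Int.fract_lt_one (c i)).ne this
    have h0 : 0 < h := by rw [hh] at hpos; exact_mod_cast hpos
    have h2 : 2 ≤ h := by omega
    have h2' : (0 : ℝ) ≤ h - 2 := by
      have : (2 : ℝ) ≤ h := by exact_mod_cast h2
      linarith
    have hd : ∀ i, (fun j => 1 - Int.fract (c j) + if j = i then ((h : ℝ) - 2) else 0) = m := by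
      intro i
      rw [← hm]
      refine ⟨?_, ?_, ?_⟩
      · have := Λ.sub_mem (hint fun j => 1 + if j = i then h - 2 else 0) (hfr c hc)
        convert this using 1
        ext j
        simp only [Pi.sub_apply]
        push_cast
        ring
      · intro j
        have := Int.fract_lt_one (c j)
        split_ifs <;> linarith
      · rw [Finset.sum_add_distrib, Finset.sum_sub_distrib, hh]
        simp [hcard]
        ring
    have heq : (h : ℝ) = 2 := by
      have : Nontrivial ι := Fintype.one_lt_card_iff_nontrivial.mp (by omega)
      obtain ⟨j, hj⟩ := exists_ne k
      have := congrFun ((hd k).trans (hd j).symm) k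
      simp only [if_true, if_neg hj.symm] at this
      linarith
    refine ⟨fun i => ?_, hh.trans heq⟩
    have := congrFun (hd k) i
    simp only [heq] at this
    simp at this
    linarith
  obtain ⟨hmΛ, hmpos, hmsum⟩ := (hm m).mpr rfl
  have hmfr : ∃ i, Int.fract (m i) ≠ 0 := by
    by_contra! hcon
    have : ∀ i, 1 ≤ m i := by
      intro i
      have h1 := hmpos i
      have h2 := Int.self_sub_floor (m i)
      rw [hcon i] at h2
      have h3 : m i = ⌊m i⌋ := by linarith
      rw [h3] at h1 ⊢
      exact_mod_cast h1
    have := Finset.sum_le_sum fun i (_ : i ∈ Finset.univ) => this i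
    rw [hmsum] at this
    simp [hcard] at this
    linarith
  obtain ⟨hf, hs⟩ := key m hmΛ hmfr
  have hneg : ∀ i, Int.fract (-m i) = 1 - m i := (key (-m) (Λ.neg_mem hmΛ) (by
    obtain ⟨i, hi⟩ := hmfr
    exact ⟨i, by simpa [Int.fract_neg_eq_zero] using hi⟩)).1
  set T : Finset ι := Finset.univ.filter fun i => Int.fract (m i) ≠ 0 with hT
  have hval : ∀ i, Int.fract (m i) = if i ∈ T then (1 / 2 : ℝ) else 0 := by
    intro i
    by_cases hi : Int.fract (m i) = 0
    · simp [hT, hi]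
    · have := Int.fract_neg hi
      rw [hneg, ← hf] at this
      rw [if_pos (by simpa [hT] using hi)]
      linarith
  refine ⟨T, ?_, ?_, ?_⟩
  · simp_rw [hval] at hs
    rw [Finset.sum_ite_mem, Finset.univ_inter, Finset.sum_const, nsmul_eq_mul] at hs
    have : (T.card : ℝ) = 4 := by linarith
    exact_mod_cast this
  · simp_rw [← hval]
    exact hfr m hmΛ
  · intro c hc
    by_cases hcz : ∃ i, Int.fract (c i) ≠ 0
    · right
      refine ⟨fun i => ⌊c i⌋, fun i => ?_⟩
      rw [← hval, hf, ← (key c hc hcz).1 i, Int.floor_add_fract]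
    · left
      push Not at hcz
      refine ⟨fun i => ⌊c i⌋, fun i => ?_⟩
      have := Int.floor_add_fract (c i)
      rw [hcz i] at this
      linarith

/-- A lattice `n`-polytope with `n + 1` lattice points is a simplex on its lattice points. -/
lemma exists_affineBasis_of_ncard {n : ℕ} {D : Set (Fin n → ℝ)} (hD : IsLatticePolytope n D)
    (hcard : (D ∩ lat n).ncard = n + 1) :
    ∃ b : AffineBasis (Option (Fin n)) ℝ (Fin n → ℝ),
      D = convexHull ℝ (range b) ∧ range b = D ∩ lat n := by
  obtain ⟨⟨S, -, hS⟩, hspan⟩ := hD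
  set s : Set (Fin n → ℝ) := (fun m : Fin n → ℤ => fun i => (m i : ℝ)) '' (S : Set (Fin n → ℤ))
  have hsD : s ⊆ D ∩ lat n := by
    refine subset_inter (hS ▸ subset_convexHull ℝ s) ?_
    rintro _ ⟨m, -, rfl⟩ i
    exact ⟨m i, rfl⟩
  have hfin : (D ∩ lat n).Finite := Set.finite_of_ncard_ne_zero (by omega)
  obtain ⟨t, hts, htspan, hind⟩ := exists_affineIndependent ℝ (Fin n → ℝ) s
  have htop : affineSpan ℝ t = ⊤ := by
    rw [htspan, ← hspan, hS, affineSpan_convexHull]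
  have htfin : t.Finite := hfin.subset (hts.trans hsD)
  have : Fintype t := htfin.fintype
  have htcard : Fintype.card t = n + 1 := by
    have := hind.affineSpan_eq_top_iff_card_eq_finrank_add_one.mp (by simpa using htop)
    simpa using this
  have ht : t = D ∩ lat n := by
    refine Set.eq_of_subset_of_ncard_le (hts.trans hsD) ?_ hfin
    rw [hcard, ← Nat.card_coe_set_eq, Nat.card_eq_fintype_card, htcard]
  have hst : s = t := (hsD.trans ht.ge).antisymm hts
  let e : t ≃ Option (Fin n) := Fintype.equivOfCardEq (by simp [htcard])
  let b₀ : AffineBasis t ℝ (Fin n → ℝ) := ⟨Subtype.val, hind, by simpa using htop⟩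
  have hr : range (b₀.reindex e) = t := by
    rw [AffineBasis.coe_reindex, EquivLike.range_comp]
    exact Subtype.range_val
  exact ⟨b₀.reindex e, by rw [hr, hS, hst], by rw [hr, ht]⟩

/-- The weights on `ι` with integral sum and integral weighted sum of the points `b i`. -/
def latticeWeights {ι : Type*} [Fintype ι] {n : ℕ} (b : ι → Fin n → ℝ) :
    AddSubgroup (ι → ℝ) where
  carrier := {c | (∃ z : ℤ, ∑ i, c i = z) ∧ ∑ i, c i • b i ∈ lat n}
  zero_mem' := ⟨⟨0, by simp⟩, fun j => ⟨0, by simp⟩⟩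
  add_mem' := by
    rintro c d ⟨⟨x, hx⟩, hc⟩ ⟨⟨y, hy⟩, hd⟩
    refine ⟨⟨x + y, by simp [Finset.sum_add_distrib, hx, hy]⟩, fun j => ?_⟩
    obtain ⟨p, hp⟩ := hc j
    obtain ⟨q, hq⟩ := hd j
    refine ⟨p + q, ?_⟩
    simp only [Pi.add_apply, add_smul, Finset.sum_add_distrib, hp, hq]
    push_cast
    rfl
  neg_mem' := by
    rintro c ⟨⟨x, hx⟩, hc⟩
    refine ⟨⟨-x, by simp [hx]⟩, fun j => ?_⟩
    obtain ⟨p, hp⟩ := hc j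
    refine ⟨-p, ?_⟩
    simp only [Pi.neg_apply, neg_smul, Finset.sum_neg_distrib, hp]
    push_cast
    rfl

lemma exists_intCast_eq_of_mem_lat {n : ℕ} {x : Fin n → ℝ} (hx : x ∈ lat n) :
    ∃ z : Fin n → ℤ, x = fun i => (z i : ℝ) := by
  choose z hz using hx
  exact ⟨z, funext hz⟩

lemma AffineBasis.coord_sum_smul {ι : Type*} [Fintype ι] {n : ℕ}
    (b : AffineBasis ι ℝ (Fin n → ℝ)) {c : ι → ℝ} (hc : ∑ i, c i = 1) (i : ι) :
    b.coord i (∑ j, c j • b j) = c i := by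
  rw [← Finset.affineCombination_eq_linear_combination _ _ _ hc]
  exact b.coord_apply_combination_of_mem (Finset.mem_univ i) hc

lemma AffineBasis.eq_of_sum_smul_eq {ι : Type*} [Fintype ι] {n : ℕ}
    (b : AffineBasis ι ℝ (Fin n → ℝ)) {c d : ι → ℝ} {r : ℝ} (hr : r ≠ 0)
    (hc : ∑ i, c i = r) (hd : ∑ i, d i = r) (h : ∑ j, c j • b j = ∑ j, d j • b j) :
    c = d := by
  have aux : ∀ c : ι → ℝ, ∑ i, c i = r → ∀ i, b.coord i (r⁻¹ • ∑ j, c j • b j) = r⁻¹ * c i := by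
    intro c hc i
    have := b.coord_sum_smul (c := fun i => r⁻¹ * c i)
      (by rw [← Finset.mul_sum, hc, inv_mul_cancel₀ hr]) i
    simpa only [Finset.smul_sum, smul_smul] using this
  ext i
  have := (aux c hc i).symm.trans ((congrArg (fun x => b.coord i (r⁻¹ • x)) h).trans (aux d hd i))
  exact mul_left_cancel₀ (inv_ne_zero hr) this

/-- For an empty lattice simplex with one lattice point in the interior of its `(n-1)`-st dilate,
the lattice weights on the vertices are generated by the integral weights and half the indicator
of a set of four vertices. -/
lemma exists_latticeWeights_eq {n : ℕ} (hn : 3 ≤ n) {D : Set (Fin n → ℝ)}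
    (hint : ∃ m₀, interior (dilate n (n - 1) D) ∩ lat n = {m₀})
    (b : AffineBasis (Option (Fin n)) ℝ (Fin n → ℝ))
    (hb : D = convexHull ℝ (range b)) (hlat : range b = D ∩ lat n) :
    ∃ T : Finset (Option (Fin n)), T.card = 4 ∧
      (fun i => if i ∈ T then (1 / 2 : ℝ) else 0) ∈ latticeWeights b ∧
      ∀ c ∈ latticeWeights b, (∃ z : Option (Fin n) → ℤ, ∀ i, c i = z i) ∨
        ∃ z : Option (Fin n) → ℤ, ∀ i, c i = z i + if i ∈ T then (1 / 2 : ℝ) else 0 := by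
  have hr : ((n : ℝ) - 1) ≠ 0 := by
    have : (3 : ℝ) ≤ n := by exact_mod_cast hn
    linarith
  have hrpos : 0 < (n : ℝ) - 1 := by
    have : (3 : ℝ) ≤ n := by exact_mod_cast hn
    linarith
  refine exists_half_indicator n hn (by simp) (latticeWeights b) ?_ (fun c hc => hc.1) ?_ ?_
  · intro i
    refine ⟨⟨1, by simp⟩, ?_⟩
    have : ∑ j, (Pi.single i (1 : ℝ) : Option (Fin n) → ℝ) j • b j = b i := by
      simp [-Fintype.sum_option, Pi.single_apply, ite_smul]
    rw [this]
    exact (hlat.le (mem_range_self i)).2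
  · intro c hc hpos hsum
    have hmem : ∑ j, c j • b j ∈ range b := by
      rw [hlat]
      refine ⟨?_, hc.2⟩
      rw [hb, b.convexHull_eq_nonneg_coord]
      intro i
      rw [b.coord_sum_smul hsum]
      exact hpos i
    obtain ⟨i, hi⟩ := hmem
    refine ⟨i, funext fun j => ?_⟩
    rw [← b.coord_sum_smul hsum j, ← hi, b.coord_apply, Pi.single_apply]
  · have hpoint : ∀ c : Option (Fin n) → ℝ, ∑ i, c i = (n : ℝ) - 1 →
        (∑ j, c j • b j ∈ interior (dilate n (n - 1) D) ↔ ∀ i, 0 < c i) := by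
      intro c hc
      have hcast : ((n - 1 : ℕ) : ℝ) = (n : ℝ) - 1 := by
        rw [Nat.cast_sub (by omega), Nat.cast_one]
      have hdil : dilate n (n - 1) D = ((n : ℝ) - 1) • D := by
        simp only [dilate, hcast]
        rfl
      rw [hdil, interior_smul₀ hr, hb, b.interior_convexHull, Set.mem_smul_set_iff_inv_smul_mem₀ hr,
        Finset.smul_sum]
      simp only [smul_smul, mem_ofPred_eq]
      refine forall_congr' fun i => ?_
      rw [b.coord_sum_smul (c := fun i => ((n : ℝ) - 1)⁻¹ * c i)
        (by rw [← Finset.mul_sum, hc, inv_mul_cancel₀ hr])]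
      exact mul_pos_iff_of_pos_left (inv_pos.mpr hrpos)
    obtain ⟨m₀, hm₀⟩ := hint
    let m : Option (Fin n) → ℝ := fun i => ((n : ℝ) - 1) * b.coord i (((n : ℝ) - 1)⁻¹ • m₀)
    have hmsum : ∑ i, m i = (n : ℝ) - 1 := by
      rw [← Finset.mul_sum, b.sum_coord_apply_eq_one, mul_one]
    have hmb : ∑ i, m i • b i = m₀ := by
      simp only [m, mul_smul]
      rw [← Finset.smul_sum, b.linear_combination_coord_eq_self, smul_inv_smul₀ hr]
    refine ⟨m, fun c => ⟨?_, ?_⟩⟩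
    · rintro ⟨hc, hpos, hsum⟩
      have : ∑ j, c j • b j ∈ ({m₀} : Set (Fin n → ℝ)) := by
        rw [← hm₀]
        exact ⟨(hpoint c hsum).mpr hpos, hc.2⟩
      exact b.eq_of_sum_smul_eq hr hsum hmsum (this.trans hmb.symm)
    · rintro rfl
      have hmem : m₀ ∈ interior (dilate n (n - 1) D) ∩ lat n := by
        rw [hm₀]; rfl
      refine ⟨⟨⟨n - 1, by rw [hmsum]; push_cast; rfl⟩, hmb ▸ hmem.2⟩, ?_, hmsum⟩
      exact (hpoint m hmsum).mp (hmb ▸ hmem.1)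

/-- The four labels `0, e₁, e₂, e₁ + e₂ + 2e₃` of vertices of `Dn` that carry weight one half. -/
def halfLabels {n : ℕ} (hn : 3 ≤ n) : Finset (Option (Fin n)) :=
  {none, some ⟨0, by omega⟩, some ⟨1, by omega⟩, some ⟨2, by omega⟩}

lemma card_halfLabels {n : ℕ} (hn : 3 ≤ n) : (halfLabels hn).card = 4 := by
  simp [halfLabels]

lemma exists_perm_image_eq {ι : Type*} [Fintype ι] [DecidableEq ι] {s t : Finset ι}
    (h : s.card = t.card) : ∃ σ : Equiv.Perm ι, ∀ i, σ i ∈ t ↔ i ∈ s := by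
  let e : {x // x ∈ s} ≃ {x // x ∈ t} := Finset.equivOfCardEq h
  refine ⟨e.extendSubtype, fun i => ⟨fun hi => ?_, fun hi => e.extendSubtype_mem i hi⟩⟩
  by_contra hs
  exact e.extendSubtype_not_mem i hs hi

/-- For `n ≥ 3`, a lattice `n`-pyramid `D` with exactly `n+1` lattice points and exactly
one lattice point in the interior of `(n-1)D` is unimodularly equivalent to `D_n`. -/
theorem pyramid_equiv_Dn (n : ℕ) (hn : 3 ≤ n) (D : Set (Fin n → ℝ))
    (hD : IsLatticePolytope n D) (hpyr : IsPyramid n D)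
    (hcard : (D ∩ lat n).ncard = n + 1)
    (hint : ∃ m₀, interior (dilate n (n - 1) D) ∩ lat n = {m₀}) :
    ∃ A : Matrix (Fin n) (Fin n) ℤ, ∃ b : Fin n → ℤ,
      IsUnit A.det ∧ unimodularMap n A b '' D = Dn n := by
  obtain ⟨b₀, hb₀, hlat₀⟩ := exists_affineBasis_of_ncard hD hcard
  obtain ⟨T, hT, hTmem, hTgen⟩ := exists_latticeWeights_eq hn hint b₀ hb₀ hlat₀
  obtain ⟨σ, hσ⟩ := exists_perm_image_eq ((card_halfLabels hn).trans hT.symm)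
  obtain ⟨v, hv⟩ : ∃ v : Option (Fin n) → Fin n → ℤ, ∀ i, b₀ (σ i) = fun j => (v i j : ℝ) := by
    choose v hv using fun i => exists_intCast_eq_of_mem_lat (hlat₀.le (mem_range_self (σ i))).2
    exact ⟨v, hv⟩
  have hDv : D = convexHull ℝ (range fun i => fun j => (v i j : ℝ)) := by
    rw [hb₀, ← EquivLike.range_comp b₀ σ]
    congr 2
    exact funext hv
  let i₀ : Fin n := ⟨0, by omega⟩
  let i₁ : Fin n := ⟨1, by omega⟩
  let i₂ : Fin n := ⟨2, by omega⟩
  have h02 : i₀ ≠ i₂ := by simp [i₀, i₂]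
  have h12 : i₁ ≠ i₂ := by simp [i₁, i₂]
  have hhalf : ∀ f : Option (Fin n) → ℝ,
      ∑ i, (if i ∈ halfLabels hn then (1 / 2 : ℝ) else 0) * f i =
      (f none + f (some i₀) + f (some i₁) + f (some i₂)) / 2 := by
    intro f
    simp only [ite_mul, zero_mul]
    rw [Finset.sum_ite_mem, Finset.univ_inter, halfLabels, Finset.sum_insert, Finset.sum_insert,
      Finset.sum_insert, Finset.sum_singleton]
    · ring
    all_goals simp
  obtain ⟨w, hw⟩ : ∃ w : Fin n → ℤ, ∀ j,
      v none j + v (some i₀) j + v (some i₁) j + v (some i₂) j = 2 * w j := by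
    obtain ⟨w, hw⟩ := exists_intCast_eq_of_mem_lat hTmem.2
    refine ⟨w, fun j => ?_⟩
    have := congrFun hw j
    rw [← Equiv.sum_comp σ] at this
    simp only [hσ, hv, Finset.sum_apply, Pi.smul_apply, smul_eq_mul] at this
    rw [hhalf] at this
    have : (v none j + v (some i₀) j + v (some i₁) j + v (some i₂) j : ℝ) = 2 * w j := by linarith
    exact_mod_cast this
  let u : Fin n → Fin n → ℤ := fun i =>
    if i = i₂ then w - v (some i₀) - v (some i₁) else v (some i) - v none
  have hu : ∀ i, i ≠ i₂ → v (some i) - v none = u i := fun i hi => by simp [u, hi]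
  have hw' : w = u i₂ + v (some i₀) + v (some i₁) := by simp [u]; abel
  have hu₂ : v (some i₂) - v none = 2 • u i₂ + u i₀ + u i₁ := by
    rw [← hu i₀ h02, ← hu i₁ h12]
    ext j
    have := hw j
    simp [u]
    linarith
  let M := Submodule.span ℤ (range u)
  have huM : ∀ i, u i ∈ M := fun i => Submodule.subset_span (mem_range_self i)
  have hvM : ∀ i, v i - v none ∈ M := by
    rintro (_ | i)
    · simp
    · by_cases hi : i = i₂
      · rw [hi, hu₂]
        exact M.add_mem (M.add_mem (M.smul_of_tower_mem 2 (huM _)) (huM _)) (huM _)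
      · rw [hu i hi]
        exact huM i
  have hsumM : ∀ z : Option (Fin n) → ℤ, ∑ i, z i • v i - (∑ i, z i) • v none ∈ M := by
    intro z
    have : ∑ i, z i • v i - (∑ i, z i) • v none = ∑ i, z i • (v i - v none) := by
      simp only [smul_sub, Finset.sum_sub_distrib, Finset.sum_smul]
    rw [this]
    exact M.sum_mem fun i _ => M.smul_mem _ (hvM i)
  have hM : M = ⊤ := by
    rw [eq_top_iff]
    intro m _
    let x : Fin n → ℝ := fun j => ((m + v none) j : ℤ)
    have hxsum : ∑ i, b₀.coord (σ i) x = 1 :=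
      (Equiv.sum_comp σ fun i => b₀.coord i x).trans (b₀.sum_coord_apply_eq_one x)
    have hx : ∀ j, ∑ i, b₀.coord (σ i) x * v i j = ((m + v none) j : ℤ) := by
      intro j
      have := congrFun (b₀.linear_combination_coord_eq_self x) j
      rw [← Equiv.sum_comp σ] at this
      simpa only [hv, Finset.sum_apply, Pi.smul_apply, smul_eq_mul] using this
    have hxmem : (fun i => b₀.coord i x) ∈ latticeWeights b₀ := by
      refine ⟨⟨1, by rw [b₀.sum_coord_apply_eq_one]; simp⟩, ?_⟩
      rw [b₀.linear_combination_coord_eq_self]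
      exact fun j => ⟨_, rfl⟩
    rcases hTgen _ hxmem with ⟨z, hz⟩ | ⟨z, hz⟩
    · simp only [hz] at hx hxsum
      have hz1 : ∑ i, z (σ i) = 1 := by exact_mod_cast hxsum
      have := hsumM fun i => z (σ i)
      rw [hz1] at this
      convert this using 1
      ext j
      have hj := hx j
      have hj : ∑ i, z (σ i) * v i j = (m + v none) j := by exact_mod_cast hj
      simp only [Pi.sub_apply, Finset.sum_apply, Pi.smul_apply, smul_eq_mul, hj]
      simp
    · simp only [hz, hσ, add_mul, Finset.sum_add_distrib, hhalf] at hx hxsum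
      have hz1 : ∑ i, z (σ i) = -1 := by
        have h2 := hhalf fun _ => 1
        simp only [mul_one] at h2
        rw [h2] at hxsum
        have : (∑ i, z (σ i) : ℝ) = -1 := by linarith
        exact_mod_cast this
      have := M.add_mem (hsumM fun i => z (σ i))
        (M.add_mem (M.add_mem (huM i₂) (huM i₀)) (huM i₁))
      rw [hz1, ← hu i₀ h02, ← hu i₁ h12] at this
      convert this using 1
      ext j
      have hj := hx j
      have hwj : (v none j + v (some i₀) j + v (some i₁) j + v (some i₂) j : ℝ) = 2 * w j := by
        exact_mod_cast hw j
      rw [hwj, mul_div_cancel_left₀ _ two_ne_zero] at hj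
      have hj : ∑ i, z (σ i) * v i j + w j = (m + v none) j := by exact_mod_cast hj
      rw [hw'] at hj
      simp only [Pi.add_apply, Pi.sub_apply, Finset.sum_apply, Pi.smul_apply, smul_eq_mul] at hj ⊢
      linarith
  let B : Matrix (Fin n) (Fin n) ℤ := Matrix.of u
  have hB : IsUnit B := by
    rw [← Matrix.vecMul_surjective_iff_isUnit]
    have := range_vecMulLinear B
    rw [show Submodule.span ℤ (range B.row) = ⊤ from hM, LinearMap.range_eq_top] at this
    exact this
  have hBdet : IsUnit B.transpose.det := by
    rw [Matrix.det_transpose]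
    exact (Matrix.isUnit_iff_isUnit_det _).mp hB
  let A : Matrix (Fin n) (Fin n) ℤ := (B.transpose)⁻¹
  have hAu : ∀ i, A.mulVec (u i) = Pi.single i 1 := by
    intro i
    have : u i = B.transpose.mulVec (Pi.single i 1) := by
      rw [Matrix.mulVec_single_one]
      rfl
    rw [this, Matrix.mulVec_mulVec, Matrix.nonsing_inv_mul _ hBdet, Matrix.one_mulVec]
  let f : (Fin n → ℝ) →ᵃ[ℝ] (Fin n → ℝ) :=
    (Matrix.mulVecLin (A.map (Int.cast : ℤ → ℝ))).toAffineMap +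
      AffineMap.const ℝ _ fun i => ((-A.mulVec (v none)) i : ℝ)
  have hf : unimodularMap n A (-A.mulVec (v none)) = f := by
    ext x j
    simp [unimodularMap, f]
  have hfv : ∀ i, f (fun j => (v i j : ℝ)) = fun j => (A.mulVec (v i - v none) j : ℝ) := by
    intro i
    ext j
    simp [f, Matrix.mulVec, dotProduct, mul_sub, ← sub_eq_add_neg]
  refine ⟨A, -A.mulVec (v none), Matrix.isUnit_nonsing_inv_det _ hBdet, ?_⟩
  rw [hf, hDv, AffineMap.image_convexHull, Dn]
  congr 1
  have hnone : f (fun j => (v none j : ℝ)) = 0 := by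
    rw [hfv]
    ext j
    simp
  have hsome : ∀ i, i ≠ i₂ → f (fun j => (v (some i) j : ℝ)) = Pi.single i (1 : ℝ) := by
    intro i hi
    rw [hfv, hu i hi, hAu]
    ext j
    simp [Pi.single_apply]
  have hlast : f (fun j => (v (some i₂) j : ℝ)) = fun j : Fin n =>
      if (j : ℕ) = 0 ∨ (j : ℕ) = 1 then (1 : ℝ) else if (j : ℕ) = 2 then 2 else 0 := by
    rw [hfv, hu₂, Matrix.mulVec_add, Matrix.mulVec_add, Matrix.mulVec_smul, hAu, hAu, hAu]
    ext j
    simp only [Pi.add_apply, Pi.smul_apply, Pi.single_apply, Fin.ext_iff, i₀, i₁, i₂]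
    split_ifs <;> first | omega | norm_num
  ext y
  simp only [mem_image, mem_range, mem_union, mem_singleton_iff, mem_ofPred_eq]
  constructor
  · rintro ⟨_, ⟨_ | i, rfl⟩, rfl⟩
    · exact Or.inl (Or.inl hnone)
    · by_cases hi : i = i₂
      · subst hi
        exact Or.inr hlast
      · exact Or.inl (Or.inr ⟨i, fun h => hi (Fin.ext h), hsome i hi⟩)
  · rintro ((rfl | ⟨i, hi, rfl⟩) | rfl)
    · exact ⟨_, ⟨none, rfl⟩, hnone⟩
    · exact ⟨_, ⟨some i, rfl⟩, hsome i fun h => hi (congrArg Fin.val h)⟩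
    · exact ⟨_, ⟨some i₂, rfl⟩, hlast⟩
end
end
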